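/- arXiv:1709.07239 — 3 statements merged into one kernel-verified Lean document; each statement's English description precedes it below -/
import Mathlib

section
/- Let 0<p≤∞, 0<q<∞, 1<K<∞, let ω∈D with exponents β=β(ω)>0 and γ=γ(ω)>0 as in the power-type characterizations of D̂, and let {z_k} be a separated sequence in 𝔻, re-indexed as {z_{j,l}} according to the annuli A_j=A_j(K). If M>1+1/p+(β+γ)/q and λ={λ_{j,l}}∈ℓ^{p,q}, then the series F(z)=∑_{j,l} λ_{j,l}(1−|z_{j,l}|)^{M−1/p} ŵ(z_{j,l})^{−1/q}(1−conj(z_{j,l})z)^{−M} converges to an analytic function F on 𝔻, and there exists a constant C=C(K,M,ω,p,q)>0 such that ‖F‖_{A^{p,q}_ω} ≤ C‖λ‖_{ℓ^{p,q}}. -/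
open MeasureTheory Complex
open scoped ENNReal Real

noncomputable section

/-- `ŵ(r) = ∫_r^1 ω(s) ds`. -/
def wh (ω : ℝ → ℝ) (r : ℝ) : ℝ := ∫ s in r..(1:ℝ), ω s

/-- A radial weight, viewed as a function of the modulus: nonnegative and
integrable on `(0,1)`. -/
def RadialWeight (ω : ℝ → ℝ) : Prop :=
  (∀ r, 0 ≤ ω r) ∧ IntervalIntegrable ω MeasureTheory.volume 0 1

/-- The class `D̂`. -/
def Dhat (ω : ℝ → ℝ) : Prop :=
  ∃ C : ℝ, 1 ≤ C ∧ ∀ r : ℝ, 0 ≤ r → r < 1 → wh ω r ≤ C * wh ω ((1 + r) / 2)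

/-- The class `Ď`. -/
def Dcheck (ω : ℝ → ℝ) : Prop :=
  ∃ K : ℝ, 1 < K ∧ ∃ C : ℝ, 1 < C ∧ ∀ r : ℝ, 0 ≤ r → r < 1 →
    C * wh ω (1 - (1 - r) / K) ≤ wh ω r

/-- The class of doubling weights `D = D̂ ∩ Ď`. -/
def DClass (ω : ℝ → ℝ) : Prop := Dhat ω ∧ Dcheck ω

/-- The point `r e^{it}` of the circle of radius `r`. -/
def circ (r t : ℝ) : ℂ := (r : ℂ) * Complex.exp ((t : ℂ) * Complex.I)

/-- The integral means `M_p(r,f)`, `0 < p ≤ ∞` (with the sup modification for `p = ∞`). -/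
def Mp (p : ℝ≥0∞) (f : ℂ → ℂ) (r : ℝ) : ℝ :=
  if p = ⊤ then ⨆ t : ℝ, ‖f (circ r t)‖
  else ((2 * Real.pi)⁻¹ *
      ∫ t in (0:ℝ)..(2 * Real.pi), ‖f (circ r t)‖ ^ p.toReal) ^ (p.toReal)⁻¹

/-- `‖f‖_{A^{p,q}_ω} = (∫_0^1 M_p(r,f)^q ω(r) dr)^{1/q}`, computed in `ℝ≥0∞`. -/
def ApqNormE (p : ℝ≥0∞) (q : ℝ) (ω : ℝ → ℝ) (f : ℂ → ℂ) : ℝ≥0∞ :=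
  (∫⁻ r in Set.Ioo (0:ℝ) 1, ENNReal.ofReal (Mp p f r) ^ q * ENNReal.ofReal (ω r)) ^ q⁻¹

/-- A sequence in `𝔻` is separated if the pseudohyperbolic distances between
distinct points are bounded away from zero. -/
def Separated (z : ℕ → ℂ) : Prop :=
  ∃ δ : ℝ, 0 < δ ∧ ∀ k j : ℕ, k ≠ j →
    δ ≤ ‖(z k - z j) / (1 - (starRingEnd ℂ) (z k) * z j)‖

/-- The radii `r_j = 1 − K^{−j}`. -/
def rAnn (K : ℝ) (j : ℕ) : ℝ := 1 - (K ^ j)⁻¹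

/-- `z k` belongs to the annulus `A_j = {w : r_j ≤ |w| < r_{j+1}}`. -/
def annIdx (K : ℝ) (z : ℕ → ℂ) (j k : ℕ) : Prop :=
  rAnn K j ≤ ‖z k‖ ∧ ‖z k‖ < rAnn K (j + 1)

/-- The `ℓ^{p,q}`-norm of `Λ`, where the inner `ℓ^p`-norm (with the sup
modification for `p = ∞`) is taken over the indices lying in the annulus `A_j`
and the outer `ℓ^q`-norm over `j`; computed in `ℝ≥0∞`. -/
def lpqNormE (p : ℝ≥0∞) (q K : ℝ) (z : ℕ → ℂ) (Λ : ℕ → ℂ) : ℝ≥0∞ :=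
  (∑' j : ℕ,
    (if p = ⊤ then
        ⨆ k : ℕ, Set.indicator {k' : ℕ | annIdx K z j k'} (fun k' => (‖Λ k'‖₊ : ℝ≥0∞)) k
      else
        (∑' k : ℕ, Set.indicator {k' : ℕ | annIdx K z j k'}
            (fun k' => (‖Λ k'‖₊ : ℝ≥0∞) ^ p.toReal) k) ^ (p.toReal)⁻¹) ^ q) ^ q⁻¹

theorem ennreal_rpow_le_rpow_of_nonpos {x y : ℝ≥0∞} {c : ℝ} (hc : c ≤ 0) (h : x ≤ y) :
    y ^ c ≤ x ^ c := by
  obtain ⟨d, rfl⟩ : ∃ d, c = -d := ⟨-c, by ring⟩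
  rw [ENNReal.rpow_neg, ENNReal.rpow_neg, ENNReal.inv_le_inv]
  exact ENNReal.rpow_le_rpow h (by linarith)

/-- A Hölder-type inequality valid for every exponent `u > 0`. -/
theorem rpow_tsum_mul_le {ι : Type*} (f g : ι → ℝ≥0∞) {u : ℝ} (hu : 0 < u) :
    (∑' i, f i * g i) ^ u ≤ (∑' i, g i) ^ u * ∑' i, f i ^ u := by
  have hf : ∀ i, f i ≤ (∑' i, f i ^ u) ^ u⁻¹ := fun i => by
    rw [ENNReal.le_rpow_inv_iff hu]
    exact ENNReal.le_tsum i
  calc (∑' i, f i * g i) ^ u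
      ≤ (∑' i, (∑' i, f i ^ u) ^ u⁻¹ * g i) ^ u := by
        gcongr with i
        exact hf i
    _ = (∑' i, g i) ^ u * ∑' i, f i ^ u := by
        rw [ENNReal.tsum_mul_left, ENNReal.mul_rpow_of_nonneg _ _ hu.le, ← ENNReal.rpow_mul,
          inv_mul_cancel₀ hu.ne', ENNReal.rpow_one, mul_comm]

/-- The sums of `κ^{-ε|n-j|}` over `j` are bounded uniformly in `n`. -/
theorem exists_tsum_rpow_dist_le {κ : ℝ≥0∞} (h1 : 1 < κ) {ε : ℝ} (hε : 0 < ε) :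
    ∃ C : ℝ≥0∞, C ≠ ⊤ ∧ ∀ n : ℕ, ∑' j : ℕ, κ ^ (-(ε * |(n : ℝ) - j|)) ≤ C := by
  have h0 : κ ≠ 0 := (zero_lt_one.trans h1).ne'
  set σ : ℝ≥0∞ := κ ^ (-ε) with hσ
  have hσ1 : σ < 1 := ENNReal.rpow_lt_one_of_one_lt_of_neg h1 (by linarith)
  have hgeo : ∑' m : ℕ, σ ^ m ≠ ⊤ := by
    rw [ENNReal.tsum_geometric]
    exact ENNReal.inv_ne_top.2 (tsub_pos_of_lt hσ1).ne'
  refine ⟨∑' m : ℕ, σ ^ m + ∑' m : ℕ, σ ^ m, ENNReal.add_ne_top.2 ⟨hgeo, hgeo⟩, fun n => ?_⟩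
  have hterm : ∀ j : ℕ, κ ^ (-(ε * |(n : ℝ) - j|)) ≤
      σ ^ ((j : ℤ) - n).natAbs := fun j => by
    rw [hσ, ← ENNReal.rpow_natCast, ← ENNReal.rpow_mul, Nat.cast_natAbs]
    apply le_of_eq
    congr 1
    push_cast
    rw [abs_sub_comm]
    ring
  calc ∑' j : ℕ, κ ^ (-(ε * |(n : ℝ) - j|))
      ≤ ∑' j : ℕ, σ ^ ((j : ℤ) - n).natAbs := ENNReal.tsum_le_tsum hterm
    _ ≤ ∑' i : ℤ, σ ^ i.natAbs :=
        ENNReal.tsum_comp_le_tsum_of_injective (f := fun j : ℕ => (j : ℤ) - n)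
          (fun a b h => by simpa using h) (fun i : ℤ => σ ^ i.natAbs)
    _ = ∑' m : ℕ, σ ^ m + ∑' m : ℕ, σ ^ (m + 1) := by
        rw [tsum_of_nat_of_neg_add_one ENNReal.summable ENNReal.summable]
        congr 1
    _ ≤ _ := by
        refine add_le_add le_rfl ?_
        exact ENNReal.tsum_le_tsum fun m => pow_le_pow_right_of_le_one' hσ1.le (Nat.le_succ m)

theorem norm_one_sub_mul_exp_ge {ρ u : ℝ} (h0 : 0 ≤ ρ) (h1 : ρ < 1) (hu : |u| ≤ π) :
    ((1 - ρ) + |u|) / (2 * π) ≤ ‖1 - (ρ : ℂ) * exp (u * I)‖ := by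
  have hpi := Real.pi_gt_three
  have hn : ‖(ρ : ℂ) * exp (u * I)‖ = ρ := by
    rw [norm_mul, norm_exp_ofReal_mul_I, mul_one, Complex.norm_of_nonneg h0]
  have ha : 1 - ρ ≤ ‖1 - (ρ : ℂ) * exp (u * I)‖ := by
    have := norm_sub_norm_le (1 : ℂ) ((ρ : ℂ) * exp (u * I))
    rwa [hn, norm_one] at this
  have hb : |u| / π ≤ ‖1 - (ρ : ℂ) * exp (u * I)‖ := by
    have h2 : ‖exp (I * u) - 1‖ ≤ 2 * ‖1 - (ρ : ℂ) * exp (u * I)‖ := by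
      have e : exp (I * u) - 1 = (exp (u * I) - ρ * exp (u * I)) - (1 - (ρ : ℂ) * exp (u * I)) := by
        rw [mul_comm I]; ring
      have e2 : ‖exp (u * I) - ρ * exp (u * I)‖ = 1 - ρ := by
        have : exp (u * I) - ρ * exp (u * I) = ((1 - ρ : ℝ) : ℂ) * exp (u * I) := by
          push_cast; ring
        rw [this, norm_mul, norm_exp_ofReal_mul_I, mul_one, Complex.norm_of_nonneg (by linarith)]
      rw [e]
      refine (norm_sub_le _ _).trans ?_
      rw [e2]; linarith
    rw [norm_exp_I_mul_ofReal_sub_one, norm_mul, Real.norm_eq_abs, Real.norm_eq_abs] at h2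
    have h3 := Real.mul_abs_le_abs_sin (x := u / 2) (by rw [abs_div, abs_two]; linarith)
    rw [abs_div, abs_two] at h3
    have h4 : 2 / π * (|u| / 2) = |u| / π := by ring
    simp only [abs_two] at h2
    rw [h4] at h3
    linarith
  rw [div_le_iff₀ (by positivity)] at hb ⊢
  nlinarith [abs_nonneg u, norm_nonneg (1 - (ρ : ℂ) * exp (u * I))]

/-- The Forelli–Rudin estimate on circles. -/
theorem exists_lintegral_circle_le {c : ℝ} (hc : 1 < c) :
    ∃ C : ℝ≥0∞, C ≠ ⊤ ∧ ∀ a : ℂ, ‖a‖ < 1 → ∀ s : ℝ,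
      ∫⁻ t in Set.Ioc s (s + 2 * π), ‖1 - a * exp (t * I)‖ₑ ^ (-c) ≤
        C * ENNReal.ofReal (1 - ‖a‖) ^ (1 - c) := by
  set G : ℝ → ℝ≥0∞ := fun v => ENNReal.ofReal (1 + |v|) ^ (-c) with hG
  have hGm : Measurable G := by fun_prop
  have hI : ∫⁻ v, G v ≠ ⊤ := by
    have := finite_integral_one_add_norm (E := ℝ) (μ := volume) (r := c) (by simpa using hc)
    refine ne_of_lt (lt_of_eq_of_lt (lintegral_congr fun v => ?_) this)
    rw [hG, Real.norm_eq_abs, ← ENNReal.ofReal_rpow_of_pos (by positivity)]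
  refine ⟨ENNReal.ofReal ((2 * π)⁻¹) ^ (-c) * ∫⁻ v, G v, ENNReal.mul_ne_top ?_ hI,
    fun a ha s => ?_⟩
  · exact ENNReal.rpow_ne_top_of_ne_zero (by simp [Real.pi_pos]) ENNReal.ofReal_ne_top
  set δ : ℝ := 1 - ‖a‖ with hδ
  have hδ0 : 0 < δ := by linarith
  have hpi := Real.pi_pos
  set φ := arg a
  have hper : ∫⁻ t in Set.Ioc s (s + 2 * π), ‖1 - a * exp (t * I)‖ₑ ^ (-c) =
      ∫⁻ t in Set.Ioc (-φ - π) (-φ - π + 2 * π), ‖1 - a * exp (t * I)‖ₑ ^ (-c) := by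
    refine (isAddFundamentalDomain_Ioc Real.two_pi_pos s).setLIntegral_eq
      (isAddFundamentalDomain_Ioc Real.two_pi_pos _) _ fun g x => ?_
    obtain ⟨g, n, rfl⟩ := g
    have : exp (((n • (2 * π) + x : ℝ) : ℂ) * I) = exp (x * I) := by
      have e : ((n • (2 * π) + x : ℝ) : ℂ) * I = x * I + n * (2 * π * I) := by
        push_cast [zsmul_eq_mul]; ring
      rw [e, exp_periodic.int_mul n]
    have h2 : ((⟨(fun x : ℤ => x • (2 * π)) n, ⟨n, rfl⟩⟩ : AddSubgroup.zmultiples (2 * π)) +ᵥ x : ℝ) =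
        n • (2 * π) + x := rfl
    rw [h2, this]
  rw [hper]
  have hpt : ∀ t ∈ Set.Ioc (-φ - π) (-φ - π + 2 * π), ‖1 - a * exp (t * I)‖ₑ ^ (-c) ≤
      ENNReal.ofReal ((2 * π)⁻¹) ^ (-c) * ENNReal.ofReal δ ^ (-c) * G (δ⁻¹ * (t + φ)) := by
    intro t ht
    have hu : |t + φ| ≤ π := abs_le.2 ⟨by linarith [ht.1], by linarith [ht.2]⟩
    have e : a * exp (t * I) = (‖a‖ : ℂ) * exp (((t + φ : ℝ) : ℂ) * I) := by
      conv_lhs => rw [← norm_mul_exp_arg_mul_I a]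
      rw [mul_assoc, ← Complex.exp_add]
      push_cast
      congr 2
      ring
    have hlow := norm_one_sub_mul_exp_ge (norm_nonneg a) ha hu
    rw [← e] at hlow
    have e3 : ((1 - ‖a‖) + |t + φ|) / (2 * π) = (2 * π)⁻¹ * δ * (1 + |δ⁻¹ * (t + φ)|) := by
      rw [abs_mul, abs_of_pos (inv_pos.2 hδ0)]
      field_simp
      rw [hδ]
    rw [e3] at hlow
    have e4 : ENNReal.ofReal ((2 * π)⁻¹) * ENNReal.ofReal δ *
        ENNReal.ofReal (1 + |δ⁻¹ * (t + φ)|) ≤ ‖1 - a * exp (t * I)‖ₑ := by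
      rw [← ofReal_norm, ← ENNReal.ofReal_mul (by positivity),
        ← ENNReal.ofReal_mul (by positivity)]
      exact ENNReal.ofReal_le_ofReal hlow
    refine (ennreal_rpow_le_rpow_of_nonpos (by linarith) e4).trans (le_of_eq ?_)
    rw [ENNReal.mul_rpow_of_ne_top (by finiteness) (by finiteness),
      ENNReal.mul_rpow_of_ne_top (by finiteness) (by finiteness)]
  calc ∫⁻ t in Set.Ioc (-φ - π) (-φ - π + 2 * π), ‖1 - a * exp (t * I)‖ₑ ^ (-c)
      ≤ ∫⁻ t in Set.Ioc (-φ - π) (-φ - π + 2 * π), ENNReal.ofReal ((2 * π)⁻¹) ^ (-c) *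
          ENNReal.ofReal δ ^ (-c) * G (δ⁻¹ * (t + φ)) := setLIntegral_mono' measurableSet_Ioc hpt
    _ ≤ ∫⁻ t, ENNReal.ofReal ((2 * π)⁻¹) ^ (-c) *
          ENNReal.ofReal δ ^ (-c) * G (δ⁻¹ * (t + φ)) := setLIntegral_le_lintegral _ _
    _ = ENNReal.ofReal ((2 * π)⁻¹) ^ (-c) *
          ENNReal.ofReal δ ^ (-c) * (ENNReal.ofReal δ * ∫⁻ v, G v) := by
        rw [lintegral_const_mul _ (by fun_prop)]
        congr 1
        rw [lintegral_add_right_eq_self (fun t => G (δ⁻¹ * t)) φ,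
          ← lintegral_map hGm (by fun_prop), Real.map_volume_mul_left (inv_pos.2 hδ0).ne',
          inv_inv, abs_of_pos hδ0, lintegral_smul_measure, smul_eq_mul]
    _ = _ := by
        rw [sub_eq_add_neg 1 c, ENNReal.rpow_add 1 (-c) (by simpa using hδ0) (by finiteness),
          ENNReal.rpow_one]
        ring

theorem ofReal_inv_pow_eq {K : ℝ} (hK : 0 < K) (j : ℕ) :
    ENNReal.ofReal ((K ^ j)⁻¹) = ENNReal.ofReal K ^ (-(j : ℝ)) := by
  rw [ENNReal.rpow_neg, ENNReal.rpow_natCast, ENNReal.ofReal_inv_of_pos (by positivity),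
    ENNReal.ofReal_pow hK.le]

theorem one_sub_norm_le_norm {a w : ℂ} (hw : ‖w‖ ≤ 1) :
    1 - ‖a‖ ≤ ‖1 - (starRingEnd ℂ) a * w‖ := by
  have := norm_sub_norm_le (1 : ℂ) ((starRingEnd ℂ) a * w)
  rw [norm_one, norm_mul, RCLike.norm_conj] at this
  nlinarith [norm_nonneg a]

/-- A circle integral estimate integrated over an annulus at distance about `K^{-j}` from the
boundary, with `w` at distance at least `K^{-n-1}`. -/
theorem exists_setLIntegral_annulus_le {K : ℝ} (hK : 1 < K) {c : ℝ} (hc : 1 < c) :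
    ∃ C : ℝ≥0∞, C ≠ ⊤ ∧ ∀ (j n : ℕ) (w : ℂ), (K ^ (n + 1))⁻¹ ≤ 1 - ‖w‖ →
      ∫⁻ ζ in {ζ : ℂ | (K ^ (j + 1))⁻¹ / 2 ≤ 1 - ‖ζ‖ ∧ 1 - ‖ζ‖ ≤ 2 * (K ^ j)⁻¹},
        ‖1 - (starRingEnd ℂ) ζ * w‖ₑ ^ (-c) ≤
      C * ENNReal.ofReal K ^ (-(j : ℝ) + (c - 1) * min (n : ℝ) j) := by
  have hK0 : 0 < K := by linarith
  set κ := ENNReal.ofReal K with hκ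
  have hκ0 : κ ≠ 0 := by simpa [hκ] using hK0
  have hκt : κ ≠ ⊤ := ENNReal.ofReal_ne_top
  obtain ⟨C, hC, hcirc⟩ := exists_lintegral_circle_le hc
  have hb0 : ENNReal.ofReal (2 * K)⁻¹ ≠ 0 := by simpa using hK0
  refine ⟨C * ENNReal.ofReal (2 * K)⁻¹ ^ (1 - c) * 2, by finiteness, fun j n w hw => ?_⟩
  set A : Set ℂ := {ζ : ℂ | (K ^ (j + 1))⁻¹ / 2 ≤ 1 - ‖ζ‖ ∧ 1 - ‖ζ‖ ≤ 2 * (K ^ j)⁻¹} with hA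
  set S : Set ℝ := Set.Icc (1 - 2 * (K ^ j)⁻¹) (1 - (K ^ (j + 1))⁻¹ / 2) ∩ Set.Ioi 0 with hS
  have hSm : MeasurableSet S := measurableSet_Icc.inter measurableSet_Ioi
  have hAm : MeasurableSet A := by
    have hm : Measurable fun ζ : ℂ => 1 - ‖ζ‖ := by fun_prop
    exact (measurableSet_le measurable_const hm).inter (measurableSet_le hm measurable_const)
  set h : ℝ × ℝ → ℝ≥0∞ := fun p =>
    S.indicator (fun s => ‖1 - (s * (starRingEnd ℂ) w) * exp (p.2 * I)‖ₑ ^ (-c)) p.1 with hh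
  have hnw : ‖w‖ < 1 := by
    have : 0 < (K ^ (n + 1))⁻¹ := by positivity
    linarith
  have hpt : ∀ p ∈ polarCoord.target,
      ENNReal.ofReal p.1 • A.indicator (fun ζ => ‖1 - (starRingEnd ℂ) ζ * w‖ₑ ^ (-c))
        (Complex.polarCoord.symm p) ≤ h p := by
    rintro ⟨s, t⟩ hp
    have hs : 0 < s := hp.1
    by_cases hin : Complex.polarCoord.symm (s, t) ∈ A
    · have hns : ‖Complex.polarCoord.symm (s, t)‖ = s := by
        rw [Complex.norm_polarCoord_symm, abs_of_pos hs]
      have hin' := hin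
      rw [hA, Set.mem_ofPred_eq, hns] at hin'
      have hsS : s ∈ S := ⟨⟨by linarith [hin'.2], by linarith [hin'.1]⟩, hs⟩
      have hs1 : s ≤ 1 := by
        have : 0 < (K ^ (j + 1))⁻¹ / 2 := by positivity
        linarith [hin'.1]
      rw [Set.indicator_of_mem hin]
      simp only [hh]
      rw [Set.indicator_of_mem hsS]
      have e : ‖1 - (starRingEnd ℂ) (Complex.polarCoord.symm (s, t)) * w‖ₑ =
          ‖1 - (s * (starRingEnd ℂ) w) * exp (t * I)‖ₑ := by
        rw [← ofReal_norm, ← ofReal_norm, ← RCLike.norm_conj]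
        congr 2
        rw [Complex.polarCoord_symm_apply]
        simp only [map_sub, map_one, map_mul, Complex.conj_conj]
        rw [Complex.exp_mul_I, ← Complex.ofReal_cos, ← Complex.ofReal_sin]
        push_cast
        ring
      rw [e, smul_eq_mul]
      exact mul_le_of_le_one_left' (by simpa using hs1)
    · rw [Set.indicator_of_notMem hin]
      simp
  have hhm : Measurable h := by
    have : h = (S ×ˢ Set.univ).indicator
        (fun p : ℝ × ℝ => ‖1 - (p.1 * (starRingEnd ℂ) w) * exp (p.2 * I)‖ₑ ^ (-c)) := by
      ext p
      by_cases hp : p.1 ∈ S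
      · rw [Set.indicator_of_mem (by simpa using hp), hh]
        simp only
        rw [Set.indicator_of_mem hp]
      · rw [Set.indicator_of_notMem (by simpa using hp), hh]
        simp only
        rw [Set.indicator_of_notMem hp]
    rw [this]
    exact Measurable.indicator (by fun_prop) (hSm.prod MeasurableSet.univ)
  have hin : ∀ s, ∫⁻ t in Set.Ioc (-π) (-π + 2 * π), h (s, t) ≤
      S.indicator (fun _ => C * (ENNReal.ofReal (2 * K)⁻¹ ^ (1 - c) *
        κ ^ ((c - 1) * min (n : ℝ) j))) s := by
    intro s
    by_cases hs : s ∈ S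
    · simp only [hh, Set.indicator_of_mem hs]
      have hs0 : 0 < s := hs.2
      have hs1 : s ≤ 1 - (K ^ (j + 1))⁻¹ / 2 := hs.1.2
      have hKj : 0 < (K ^ (j + 1))⁻¹ := by positivity
      have hn : ‖(s : ℂ) * (starRingEnd ℂ) w‖ = s * ‖w‖ := by
        rw [norm_mul, RCLike.norm_conj, Complex.norm_of_nonneg hs0.le]
      refine (hcirc _ ?_ (-π)).trans ?_
      · rw [hn]; nlinarith [norm_nonneg w]
      rw [hn]
      gcongr
      have h1 : ENNReal.ofReal (2 * K)⁻¹ * κ ^ (-min (n : ℝ) j) ≤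
          ENNReal.ofReal (1 - s * ‖w‖) := by
        have key : ∀ m : ℕ, (K ^ (m + 1))⁻¹ / 2 ≤ 1 - s * ‖w‖ →
            ENNReal.ofReal (2 * K)⁻¹ * κ ^ (-(m : ℝ)) ≤ ENNReal.ofReal (1 - s * ‖w‖) := by
          intro m hm
          rw [hκ, ← ofReal_inv_pow_eq hK0, ← ENNReal.ofReal_mul (by positivity)]
          apply ENNReal.ofReal_le_ofReal
          refine le_trans (le_of_eq ?_) hm
          rw [pow_succ]
          field_simp
        rcases le_total n j with hnj | hnj
        · rw [min_eq_left (by exact_mod_cast hnj)]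
          apply key
          have : 0 < (K ^ (n + 1))⁻¹ := by positivity
          nlinarith [norm_nonneg w]
        · rw [min_eq_right (by exact_mod_cast hnj)]
          apply key
          nlinarith [norm_nonneg w]
      refine (ennreal_rpow_le_rpow_of_nonpos (by linarith) h1).trans (le_of_eq ?_)
      rw [ENNReal.mul_rpow_of_ne_top (by finiteness) (by finiteness), ← ENNReal.rpow_mul]
      congr 2
      ring
    · simp [hh, Set.indicator_of_notMem hs]
  have hvol : volume S ≤ 2 * κ ^ (-(j : ℝ)) := by
    refine (measure_mono Set.inter_subset_left).trans ?_
    rw [Real.volume_Icc, hκ, ← ofReal_inv_pow_eq hK0, ← ENNReal.ofReal_ofNat,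
      ← ENNReal.ofReal_mul (by norm_num)]
    apply ENNReal.ofReal_le_ofReal
    have : 0 < (K ^ (j + 1))⁻¹ := by positivity
    linarith
  have htarget : polarCoord.target ⊆ Set.univ ×ˢ Set.Ioc (-π) (-π + 2 * π) := by
    rintro ⟨s, t⟩ hp
    have := hp.2
    exact ⟨trivial, this.1, by linarith [this.2]⟩
  calc ∫⁻ ζ in A, ‖1 - (starRingEnd ℂ) ζ * w‖ₑ ^ (-c)
      = ∫⁻ p in polarCoord.target, ENNReal.ofReal p.1 •
          A.indicator (fun ζ => ‖1 - (starRingEnd ℂ) ζ * w‖ₑ ^ (-c))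
            (Complex.polarCoord.symm p) := by
        rw [Complex.lintegral_comp_polarCoord_symm, lintegral_indicator hAm]
    _ ≤ ∫⁻ p in polarCoord.target, h p :=
        setLIntegral_mono' polarCoord.open_target.measurableSet hpt
    _ ≤ ∫⁻ p in Set.univ ×ˢ Set.Ioc (-π) (-π + 2 * π), h p := lintegral_mono_set htarget
    _ = ∫⁻ s, ∫⁻ t in Set.Ioc (-π) (-π + 2 * π), h (s, t) := by
        rw [Measure.volume_eq_prod, ← Measure.prod_restrict, Measure.restrict_univ,
          lintegral_prod _ hhm.aemeasurable]
    _ ≤ ∫⁻ s, S.indicator (fun _ => C * (ENNReal.ofReal (2 * K)⁻¹ ^ (1 - c) *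
        κ ^ ((c - 1) * min (n : ℝ) j))) s := lintegral_mono hin
    _ = C * (ENNReal.ofReal (2 * K)⁻¹ ^ (1 - c) * κ ^ ((c - 1) * min (n : ℝ) j)) * volume S := by
        rw [lintegral_indicator_const hSm]
    _ ≤ C * (ENNReal.ofReal (2 * K)⁻¹ ^ (1 - c) * κ ^ ((c - 1) * min (n : ℝ) j)) *
          (2 * κ ^ (-(j : ℝ))) := by gcongr
    _ = _ := by
        rw [ENNReal.rpow_add _ _ hκ0 hκt]
        ring

/-- A discrete version of the Forelli–Rudin estimate for the part of a separated sequence lying in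
one annulus. -/
theorem Separated.exists_tsum_annIdx_le {z : ℕ → ℂ} (hz : ∀ k, ‖z k‖ < 1) (hsep : Separated z)
    {K : ℝ} (hK : 1 < K) {c : ℝ} (hc : 1 < c) :
    ∃ C : ℝ≥0∞, C ≠ ⊤ ∧ ∀ (j n : ℕ) (w : ℂ), (K ^ (n + 1))⁻¹ ≤ 1 - ‖w‖ →
      ∑' k, Set.indicator {k' : ℕ | annIdx K z j k'}
        (fun k => ‖1 - (starRingEnd ℂ) (z k) * w‖ₑ ^ (-c)) k ≤
      C * ENNReal.ofReal K ^ ((j : ℝ) + (c - 1) * min (n : ℝ) j) := by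
  have hK0 : 0 < K := by linarith
  obtain ⟨C, hC, hann⟩ := exists_setLIntegral_annulus_le hK hc
  obtain ⟨δ, hδ, hsep⟩ := hsep
  set κ := ENNReal.ofReal K with hκ
  have hκ0 : κ ≠ 0 := by simpa [hκ] using hK0
  have hκt : κ ≠ ⊤ := ENNReal.ofReal_ne_top
  set ε := min (δ / 2) (1 / 2) with hε
  have hε0 : 0 < ε := by positivity
  have hε1 : ε ≤ 1 / 2 := min_le_right _ _
  have hε2 : ε ≤ δ / 2 := min_le_left _ _
  have hεe : ENNReal.ofReal ε ≠ 0 := by simpa using hε0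
  refine ⟨2 ^ c * C * (ENNReal.ofReal ε)⁻¹ ^ 2 * κ ^ 2, ?_, fun j n w hw => ?_⟩
  · have := ENNReal.inv_ne_top.2 hεe
    finiteness
  have hnw : ‖w‖ < 1 := by
    have : 0 < (K ^ (n + 1))⁻¹ := by positivity
    linarith
  set A : Set ℂ := {ζ : ℂ | (K ^ (j + 1))⁻¹ / 2 ≤ 1 - ‖ζ‖ ∧ 1 - ‖ζ‖ ≤ 2 * (K ^ j)⁻¹} with hA
  set g : ℂ → ℝ≥0∞ := fun ζ => ‖1 - (starRingEnd ℂ) ζ * w‖ₑ ^ (-c) with hg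
  set D : ℕ → Set ℂ := fun k => Metric.ball (z k) (ε * (1 - ‖z k‖)) with hD
  have hmem : ∀ k, annIdx K z j k → ∀ ζ ∈ D k, ζ ∈ A ∧ g (z k) ≤ 2 ^ c * g ζ := by
    intro k hk ζ hζ
    have hd : ‖ζ - z k‖ < ε * (1 - ‖z k‖) := by simpa [hD, dist_eq_norm] using hζ
    have hk1 : (K ^ (j + 1))⁻¹ < 1 - ‖z k‖ := by
      have := hk.2; rw [rAnn] at this; linarith
    have hk2 : 1 - ‖z k‖ ≤ (K ^ j)⁻¹ := by
      have := hk.1; rw [rAnn] at this; linarith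
    have hpos : 0 < 1 - ‖z k‖ := by linarith [hz k]
    have hd2 : ‖ζ - z k‖ < (1 - ‖z k‖) / 2 := by nlinarith
    have h1 : ‖ζ‖ ≤ ‖z k‖ + ‖ζ - z k‖ := by
      simpa using norm_add_le (z k) (ζ - z k)
    have h2 : ‖z k‖ ≤ ‖ζ‖ + ‖ζ - z k‖ := by
      rw [norm_sub_rev]
      simpa using norm_add_le ζ (z k - ζ)
    refine ⟨⟨by linarith, by linarith⟩, ?_⟩
    have h3 : ‖1 - (starRingEnd ℂ) ζ * w‖ ≤ 2 * ‖1 - (starRingEnd ℂ) (z k) * w‖ := by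
      have e : 1 - (starRingEnd ℂ) ζ * w =
          (1 - (starRingEnd ℂ) (z k) * w) - (starRingEnd ℂ) (ζ - z k) * w := by
        rw [map_sub]; ring
      have h4 := norm_sub_le (1 - (starRingEnd ℂ) (z k) * w) ((starRingEnd ℂ) (ζ - z k) * w)
      rw [← e, norm_mul, RCLike.norm_conj] at h4
      have h5 := one_sub_norm_le_norm (a := z k) hnw.le
      nlinarith [norm_nonneg (ζ - z k)]
    have h4 : ‖1 - (starRingEnd ℂ) ζ * w‖ₑ ≤ 2 * ‖1 - (starRingEnd ℂ) (z k) * w‖ₑ := by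
      rw [← ofReal_norm, ← ofReal_norm, ← ENNReal.ofReal_ofNat, ← ENNReal.ofReal_mul (by norm_num)]
      exact ENNReal.ofReal_le_ofReal h3
    have h5 := ennreal_rpow_le_rpow_of_nonpos (c := -c) (by linarith) h4
    rw [ENNReal.mul_rpow_of_ne_top (by finiteness) (by finiteness)] at h5
    calc g (z k) = 2 ^ c * (2 ^ (-c) * g (z k)) := by
          rw [← mul_assoc, ← ENNReal.rpow_add _ _ (by norm_num) (by norm_num)]
          simp
      _ ≤ 2 ^ c * g ζ := by gcongr
  set v : ℝ≥0∞ := ENNReal.ofReal ε ^ 2 * κ ^ (-(2 * ((j : ℝ) + 1))) with hv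
  have hv0 : v ≠ 0 := by
    have : κ ^ (-(2 * ((j : ℝ) + 1))) ≠ 0 := by
      rw [Ne, ENNReal.rpow_eq_zero_iff]; tauto
    positivity
  have hvt : v ≠ ⊤ := by finiteness
  have hvol : ∀ k, annIdx K z j k → v ≤ volume (D k) := by
    intro k hk
    have hk1 : (K ^ (j + 1))⁻¹ ≤ 1 - ‖z k‖ := by
      have := hk.2; rw [rAnn] at this; linarith
    rw [hD, Complex.volume_ball, hv]
    have e : κ ^ (-(2 * ((j : ℝ) + 1))) = ENNReal.ofReal ((K ^ (j + 1))⁻¹) ^ 2 := by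
      rw [ofReal_inv_pow_eq hK0, ← ENNReal.rpow_natCast, ← ENNReal.rpow_mul]
      push_cast
      congr 1
      ring
    rw [e, ENNReal.ofReal_mul hε0.le, mul_pow]
    have hpi : (1 : ℝ≥0∞) ≤ NNReal.pi := by
      rw [← ENNReal.coe_one, ENNReal.coe_le_coe, ← NNReal.coe_le_coe]
      simpa using by linarith [Real.pi_gt_three]
    calc _ ≤ ENNReal.ofReal ε ^ 2 * ENNReal.ofReal (1 - ‖z k‖) ^ 2 := by gcongr
      _ ≤ _ := le_mul_of_one_le_right' hpi
  set E : ℕ → Set ℂ := fun k => {ζ | annIdx K z j k ∧ ζ ∈ D k} with hE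
  have hEm : ∀ k, MeasurableSet (E k) := fun k =>
    (MeasurableSet.const _).inter Metric.isOpen_ball.measurableSet
  have hdisj : Pairwise (Function.onFun Disjoint E) := by
    intro k l hkl
    rw [Function.onFun, Set.disjoint_left]
    rintro ζ ⟨-, h1⟩ ⟨-, h2⟩
    have d1 : dist ζ (z k) < ε * (1 - ‖z k‖) := h1
    have d2 : dist ζ (z l) < ε * (1 - ‖z l‖) := h2
    have d3 : ‖z k - z l‖ < ε * (1 - ‖z k‖) + ε * (1 - ‖z l‖) := by
      rw [← dist_eq_norm]
      refine (dist_triangle_left _ _ ζ).trans_lt (by linarith)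
    have h5 := one_sub_norm_le_norm (a := z k) (hz l).le
    have h6 := one_sub_norm_le_norm (a := z l) (hz k).le
    have h7 : ‖1 - (starRingEnd ℂ) (z l) * z k‖ = ‖1 - (starRingEnd ℂ) (z k) * z l‖ := by
      rw [← RCLike.norm_conj]
      simp [mul_comm]
    have hp : 0 < ‖1 - (starRingEnd ℂ) (z k) * z l‖ := by linarith [hz k]
    have h8 := hsep k l hkl
    rw [norm_div, le_div_iff₀ hp] at h8
    nlinarith
  have hterm : ∀ k, Set.indicator {k' : ℕ | annIdx K z j k'} (fun k => g (z k)) k * v ≤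
      2 ^ c * ∫⁻ ζ in E k, g ζ := by
    intro k
    by_cases hk : annIdx K z j k
    · rw [Set.indicator_of_mem (by exact hk)]
      have hEk : E k = D k := by ext; simp [hE, hk]
      rw [hEk, ← lintegral_const_mul' _ _ (by finiteness)]
      calc g (z k) * v ≤ g (z k) * volume (D k) := by gcongr; exact hvol k hk
        _ = ∫⁻ _ in D k, g (z k) := (setLIntegral_const _ _).symm
        _ ≤ _ := setLIntegral_mono' Metric.isOpen_ball.measurableSet
            fun ζ hζ => (hmem k hk ζ hζ).2
    · rw [Set.indicator_of_notMem (by exact hk)]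
      simp
  have hsum : (∑' k, Set.indicator {k' : ℕ | annIdx K z j k'} (fun k => g (z k)) k) * v ≤
      2 ^ c * (C * κ ^ (-(j : ℝ) + (c - 1) * min (n : ℝ) j)) := by
    rw [← ENNReal.tsum_mul_right]
    refine (ENNReal.tsum_le_tsum hterm).trans ?_
    rw [ENNReal.tsum_mul_left, ← lintegral_iUnion hEm hdisj]
    gcongr
    refine (lintegral_mono_set ?_).trans (hann j n w hw)
    exact Set.iUnion_subset fun k ζ hζ => (hmem k hζ.1 ζ hζ.2).1
  rw [← ENNReal.le_div_iff_mul_le (Or.inl hv0) (Or.inl hvt)] at hsum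
  refine hsum.trans (le_of_eq ?_)
  rw [ENNReal.div_eq_inv_mul, hv, ENNReal.mul_inv (Or.inr (by finiteness)) (Or.inl (by finiteness)),
    ← ENNReal.rpow_neg, ENNReal.inv_pow]
  have e : κ ^ (- -(2 * ((j : ℝ) + 1))) * κ ^ (-(j : ℝ) + (c - 1) * min (n : ℝ) j) =
      κ ^ 2 * κ ^ ((j : ℝ) + (c - 1) * min (n : ℝ) j) := by
    rw [← ENNReal.rpow_natCast, ← ENNReal.rpow_add _ _ hκ0 hκt, ← ENNReal.rpow_add _ _ hκ0 hκt]
    congr 1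
    push_cast
    ring
  calc _ = 2 ^ c * C * (ENNReal.ofReal ε)⁻¹ ^ 2 * (κ ^ (- -(2 * ((j : ℝ) + 1))) *
        κ ^ (-(j : ℝ) + (c - 1) * min (n : ℝ) j)) := by ring
    _ = _ := by rw [e]; ring

theorem one_sub_rAnn (K : ℝ) (j : ℕ) : 1 - rAnn K j = (K ^ j)⁻¹ := by
  rw [rAnn]; ring

theorem rAnn_lt_one {K : ℝ} (hK : 1 < K) (j : ℕ) : rAnn K j < 1 := by
  have : 0 < (K ^ j)⁻¹ := by positivity
  rw [rAnn]; linarith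

theorem rAnn_nonneg {K : ℝ} (hK : 1 < K) (j : ℕ) : 0 ≤ rAnn K j := by
  have : (K ^ j)⁻¹ ≤ 1 := inv_le_one_of_one_le₀ (one_le_pow₀ hK.le)
  rw [rAnn]; linarith

theorem rAnn_mono {K : ℝ} (hK : 1 < K) : Monotone (rAnn K) := by
  intro i j hij
  have : (K ^ j)⁻¹ ≤ (K ^ i)⁻¹ := by
    gcongr
    exact hK.le
  rw [rAnn, rAnn]; linarith

/-- The annuli `[r_j, r_{j+1})` cover `[0, 1)`. -/
theorem exists_rAnn_le_lt {K : ℝ} (hK : 1 < K) {x : ℝ} (h0 : 0 ≤ x) (h1 : x < 1) :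
    ∃ j : ℕ, rAnn K j ≤ x ∧ x < rAnn K (j + 1) := by
  obtain ⟨j, hj1, hj2⟩ := exists_nat_pow_near_of_lt_one (x := 1 - x) (y := K⁻¹) (by linarith)
    (by linarith) (by positivity) (inv_lt_one_of_one_lt₀ hK)
  rw [inv_pow] at hj1 hj2
  exact ⟨j, by rw [rAnn]; linarith, by rw [rAnn]; linarith⟩

theorem rAnn_index_unique {K : ℝ} (hK : 1 < K) {x : ℝ} {i j : ℕ}
    (hi : rAnn K i ≤ x ∧ x < rAnn K (i + 1)) (hj : rAnn K j ≤ x ∧ x < rAnn K (j + 1)) :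
    i = j := by
  rcases lt_trichotomy i j with h | h | h
  · have := rAnn_mono hK (show i + 1 ≤ j from h)
    linarith [hi.2, hj.1]
  · exact h
  · have := rAnn_mono hK (show j + 1 ≤ i from h)
    linarith [hj.2, hi.1]

section Weights

variable {ω : ℝ → ℝ}

theorem RadialWeight.intervalIntegrable (hω : RadialWeight ω) {a b : ℝ} (ha : 0 ≤ a) (hab : a ≤ b)
    (hb : b ≤ 1) : IntervalIntegrable ω volume a b :=
  hω.2.mono_set (by
    rw [Set.uIcc_of_le hab, Set.uIcc_of_le zero_le_one]
    exact Set.Icc_subset_Icc ha hb)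

theorem RadialWeight.wh_nonneg (hω : RadialWeight ω) {r : ℝ} (hr : r ≤ 1) : 0 ≤ wh ω r :=
  intervalIntegral.integral_nonneg hr fun x _ => hω.1 x

theorem RadialWeight.wh_sub (hω : RadialWeight ω) {r s : ℝ} (hr : 0 ≤ r) (hrs : r ≤ s)
    (hs : s ≤ 1) : (∫ x in r..s, ω x) = wh ω r - wh ω s := by
  rw [wh, wh, eq_sub_iff_add_eq]
  exact intervalIntegral.integral_add_adjacent_intervals (hω.intervalIntegrable hr hrs hs)
    (hω.intervalIntegrable (hr.trans hrs) hs le_rfl)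

theorem RadialWeight.wh_anti (hω : RadialWeight ω) {r s : ℝ} (hr : 0 ≤ r) (hrs : r ≤ s)
    (hs : s ≤ 1) : wh ω s ≤ wh ω r := by
  have h1 := hω.wh_sub hr hrs hs
  have h2 : 0 ≤ ∫ x in r..s, ω x := intervalIntegral.integral_nonneg hrs fun x _ => hω.1 x
  linarith

theorem RadialWeight.setLIntegral_le (hω : RadialWeight ω) {r s : ℝ} (hr : 0 ≤ r) (hrs : r ≤ s)
    (hs : s ≤ 1) : ∫⁻ x in Set.Ico r s, ENNReal.ofReal (ω x) ≤ ENNReal.ofReal (wh ω r) := by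
  have hint : IntegrableOn ω (Set.Ioc r s) :=
    (intervalIntegrable_iff_integrableOn_Ioc_of_le hrs).1 (hω.intervalIntegrable hr hrs hs)
  rw [setLIntegral_congr Ico_ae_eq_Ioc,
    ← ofReal_integral_eq_lintegral_ofReal hint (Filter.Eventually.of_forall hω.1),
    ← intervalIntegral.integral_of_le hrs, hω.wh_sub hr hrs hs]
  exact ENNReal.ofReal_le_ofReal (by linarith [hω.wh_nonneg hs])

/-- Geometric decay of the tails of a weight in `Ď` along the radii `r_j`. -/
theorem Dcheck.exists_wh_rAnn_le (hω : RadialWeight ω) (hD : Dcheck ω) {K : ℝ} (hK : 1 < K) :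
    ∃ α : ℝ, 0 < α ∧ ∃ C : ℝ, 0 < C ∧ ∀ j d : ℕ,
      wh ω (rAnn K (j + d)) ≤ C * K ^ (-(α * d)) * wh ω (rAnn K j) := by
  have hK0 : 0 < K := by linarith
  obtain ⟨K', hK', C, hC, h⟩ := hD
  obtain ⟨L, hL⟩ := pow_unbounded_of_one_lt K' hK
  have hL0 : 0 < L := by
    rcases Nat.eq_zero_or_pos L with rfl | h
    · simp at hL; linarith
    · exact h
  have hstep : ∀ j, C * wh ω (rAnn K (j + L)) ≤ wh ω (rAnn K j) := by
    intro j
    have h1 := h (rAnn K j) (rAnn_nonneg hK j) (rAnn_lt_one hK j)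
    rw [one_sub_rAnn] at h1
    refine le_trans ?_ h1
    have hj1 : (K ^ j)⁻¹ ≤ 1 := inv_le_one_of_one_le₀ (one_le_pow₀ hK.le)
    have hj0 : 0 < (K ^ j)⁻¹ := by positivity
    have h3 : (K ^ j)⁻¹ / K' ≤ 1 := by
      rw [div_le_one (by linarith)]; linarith
    have h2 : rAnn K (j + L) ≥ 1 - (K ^ j)⁻¹ / K' := by
      rw [rAnn, pow_add, mul_inv, ← div_eq_mul_inv]
      gcongr
    gcongr
    exact hω.wh_anti (by linarith) h2 (rAnn_lt_one hK _).le
  have hlog : 0 < Real.log K := Real.log_pos hK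
  have hlogC : 0 < Real.log C := Real.log_pos hC
  have hLr : (0 : ℝ) < L := by exact_mod_cast hL0
  set α := Real.log C / (L * Real.log K) with hα
  have hα0 : 0 < α := by positivity
  have hCα : K ^ (α * L) = C := by
    rw [Real.rpow_def_of_pos hK0, hα]
    have : Real.log K * (Real.log C / (L * Real.log K) * L) = Real.log C := by
      field_simp
    rw [this, Real.exp_log (by linarith)]
  refine ⟨α, hα0, C, by linarith, fun j d => ?_⟩
  have hWj := hω.wh_nonneg (rAnn_lt_one hK j).le
  induction d using Nat.strong_induction_on with
  | _ d ih =>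
    rcases lt_or_ge d L with hd | hd
    · have h1 : 1 ≤ C * K ^ (-(α * d)) := by
        rw [← hCα, ← Real.rpow_add hK0]
        apply Real.one_le_rpow hK.le
        have : (d : ℝ) ≤ L := by exact_mod_cast hd.le
        nlinarith
      have h2 := hω.wh_anti (rAnn_nonneg hK j) (rAnn_mono hK (Nat.le_add_right j d))
        (rAnn_lt_one hK _).le
      nlinarith
    · obtain ⟨e, rfl⟩ := Nat.exists_eq_add_of_le' hd
      have h1 := hstep (j + e)
      have h2 := ih e (by omega)
      rw [← add_assoc]
      have h3 : C * K ^ (-(α * ((e + L : ℕ) : ℝ))) = K ^ (-(α * e)) := by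
        rw [← hCα, ← Real.rpow_add hK0]
        congr 1
        push_cast
        ring
      rw [h3]
      have h4 : C * wh ω (rAnn K (j + e + L)) ≤ C * (K ^ (-(α * e)) * wh ω (rAnn K j)) := by
        refine h1.trans (h2.trans (le_of_eq (by ring)))
      exact le_of_mul_le_mul_left h4 (by linarith)

variable {K β Cβ q : ℝ}

theorem wh_rpow_le_of_annIdx (hω : RadialWeight ω) (hK : 1 < K)
    (hβcond : ∀ r t : ℝ, 0 ≤ r → r ≤ t → t < 1 →
      wh ω r ≤ Cβ * ((1 - r) / (1 - t)) ^ β * wh ω t) (hq : 0 < q)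
    {j : ℕ} {x : ℝ} (h0 : 0 ≤ x) (hx : x < rAnn K (j + 1)) :
    wh ω x ^ (-(1 / q)) ≤ wh ω (rAnn K (j + 1)) ^ (-(1 / q)) := by
  have h1 := rAnn_lt_one hK (j + 1)
  have hanti := hω.wh_anti h0 hx.le h1.le
  have hq' : -(1 / q) < 0 := by
    have : 0 < 1 / q := by positivity
    linarith
  rcases (hω.wh_nonneg h1.le).eq_or_lt with h | h
  · have h2 := hβcond x _ h0 hx.le h1
    rw [← h, mul_zero] at h2
    have h3 : wh ω x = 0 := le_antisymm h2 (hω.wh_nonneg (by linarith))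
    rw [h3, h]
  · exact Real.rpow_le_rpow_of_nonpos h hanti hq'.le

theorem wh_rAnn_le_of_le (hK : 1 < K) (hβcond : ∀ r t : ℝ, 0 ≤ r → r ≤ t → t < 1 →
      wh ω r ≤ Cβ * ((1 - r) / (1 - t)) ^ β * wh ω t) {n j : ℕ} (hnj : n ≤ j) :
    wh ω (rAnn K n) ≤ Cβ * K ^ (((j : ℝ) - n) * β) * wh ω (rAnn K j) := by
  have hK0 : 0 < K := by linarith
  have h := hβcond _ _ (rAnn_nonneg hK n) (rAnn_mono hK hnj) (rAnn_lt_one hK j)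
  rw [one_sub_rAnn, one_sub_rAnn] at h
  convert h using 3
  rw [Real.rpow_mul hK0.le, Real.rpow_sub hK0, Real.rpow_natCast, Real.rpow_natCast]
  congr 1
  field_simp

/-- Growth of `ŵ(r_{j+1})^{-1/q}`. -/
theorem exists_wh_rAnn_rpow_le (hω : RadialWeight ω) (hK : 1 < K) (hCβ : 0 < Cβ)
    (hβcond : ∀ r t : ℝ, 0 ≤ r → r ≤ t → t < 1 →
      wh ω r ≤ Cβ * ((1 - r) / (1 - t)) ^ β * wh ω t) (hq : 0 < q) :
    ∃ C : ℝ, 0 < C ∧ ∀ j : ℕ,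
      wh ω (rAnn K (j + 1)) ^ (-(1 / q)) ≤ C * K ^ (β / q * j) := by
  have hK0 : 0 < K := by linarith
  have hq' : -(1 / q) < 0 := by
    have : 0 < 1 / q := by positivity
    linarith
  rcases (hω.wh_nonneg (rAnn_lt_one hK 0).le).eq_or_lt with h0 | h0
  · refine ⟨1, one_pos, fun j => ?_⟩
    have h1 := hω.wh_anti (rAnn_nonneg hK 0) (rAnn_mono hK (Nat.zero_le (j + 1)))
      (rAnn_lt_one hK _).le
    rw [← h0] at h1
    rw [le_antisymm h1 (hω.wh_nonneg (rAnn_lt_one hK _).le), Real.zero_rpow hq'.ne]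
    positivity
  · set W := wh ω (rAnn K 0) with hW
    refine ⟨(W / (Cβ * K ^ β)) ^ (-(1 / q)), by positivity, fun j => ?_⟩
    have h1 := wh_rAnn_le_of_le hK hβcond (Nat.zero_le (j + 1))
    have h2 : W / (Cβ * K ^ β) * K ^ (-(β * j)) ≤ wh ω (rAnn K (j + 1)) := by
      rw [Real.rpow_neg hK0.le, ← div_eq_mul_inv, div_div, div_le_iff₀ (by positivity)]
      refine h1.trans (le_of_eq ?_)
      rw [mul_assoc Cβ (K ^ β), ← Real.rpow_add hK0, mul_comm (wh _ _)]
      congr 3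
      push_cast
      ring
    refine (Real.rpow_le_rpow_of_nonpos (by positivity) h2 hq'.le).trans (le_of_eq ?_)
    rw [Real.mul_rpow (by positivity) (by positivity), ← Real.rpow_mul hK0.le]
    congr 2
    field_simp

/-- Off-diagonal decay of `ŵ(r_n) / ŵ(r_{j+1})` after multiplication by `K^{-ηq(j-n)⁺}`. -/
theorem exists_wh_ratio_le (hω : RadialWeight ω) (hD : Dcheck ω) (hK : 1 < K) (hCβ : 0 < Cβ)
    (hβcond : ∀ r t : ℝ, 0 ≤ r → r ≤ t → t < 1 →
      wh ω r ≤ Cβ * ((1 - r) / (1 - t)) ^ β * wh ω t) (hq : 0 < q) {η : ℝ} (hη : β / q < η) :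
    ∃ α : ℝ, 0 < α ∧ ∃ C : ℝ≥0∞, C ≠ ⊤ ∧ ∀ n j : ℕ,
      ENNReal.ofReal (wh ω (rAnn K n)) *
        (ENNReal.ofReal (wh ω (rAnn K (j + 1)) ^ (-(1 / q))) *
          ENNReal.ofReal K ^ (-(η * (j - min (n : ℝ) j)))) ^ q ≤
      C * ENNReal.ofReal K ^ (-(α * |(n : ℝ) - j|)) := by
  have hK0 : 0 < K := by linarith
  have hηq : 0 < η * q - β := by
    rw [div_lt_iff₀ hq] at hη; linarith
  obtain ⟨α₁, hα₁, C₁, hC₁, hdec⟩ := hD.exists_wh_rAnn_le hω hK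
  refine ⟨min α₁ (η * q - β), lt_min hα₁ hηq,
    ENNReal.ofReal (Cβ * K ^ |β| + C₁ * K ^ α₁), ENNReal.ofReal_ne_top, fun n j => ?_⟩
  set α := min α₁ (η * q - β) with hα
  have hαa : α ≤ α₁ := min_le_left _ _
  have hαb : α ≤ η * q - β := min_le_right _ _
  have hα0 : 0 < α := lt_min hα₁ hηq
  set W := wh ω (rAnn K (j + 1)) with hW
  have hW0 : 0 ≤ W := hω.wh_nonneg (rAnn_lt_one hK _).le
  rw [ENNReal.ofReal_rpow_of_pos hK0, ENNReal.ofReal_rpow_of_pos hK0,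
    ← ENNReal.ofReal_mul (by positivity), ENNReal.ofReal_rpow_of_nonneg (by positivity) hq.le,
    ← ENNReal.ofReal_mul (hω.wh_nonneg (rAnn_lt_one hK _).le),
    ← ENNReal.ofReal_mul (by positivity)]
  apply ENNReal.ofReal_le_ofReal
  rw [Real.mul_rpow (by positivity) (by positivity), ← Real.rpow_mul hW0, ← Real.rpow_mul hK0.le]
  have e1 : -(1 / q) * q = -1 := by field_simp
  rw [e1, Real.rpow_neg_one]
  rcases hW0.eq_or_lt with h0 | h0
  · rw [← h0]
    simp only [inv_zero, zero_mul, mul_zero]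
    positivity
  rcases Nat.lt_or_ge j n with hnj | hnj
  · obtain ⟨d, rfl⟩ := Nat.exists_eq_add_of_le (show j + 1 ≤ n from hnj)
    have h1 := hdec (j + 1) d
    have h2 : min (((j + 1 + d : ℕ) : ℝ)) j = j := min_eq_right (by push_cast; linarith)
    have h3 : |(((j + 1 + d : ℕ) : ℝ)) - j| = d + 1 := by
      rw [abs_of_nonneg] <;> push_cast <;> linarith
    rw [h2, h3]
    simp only [sub_self, mul_zero, neg_zero, zero_mul, Real.rpow_zero, mul_one]
    rw [← div_eq_mul_inv, div_le_iff₀ h0]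
    refine h1.trans (mul_le_mul_of_nonneg_right ?_ h0.le)
    have h4 : C₁ * K ^ (-(α₁ * (d : ℝ))) = C₁ * K ^ α₁ * K ^ (-(α₁ * ((d : ℝ) + 1))) := by
      rw [mul_assoc, ← Real.rpow_add hK0]; congr 2; ring
    rw [h4]
    have h5 : K ^ (-(α₁ * ((d : ℝ) + 1))) ≤ K ^ (-(α * ((d : ℝ) + 1))) := by
      apply Real.rpow_le_rpow_of_exponent_le hK.le
      gcongr
    have h6 : 0 ≤ Cβ * K ^ |β| := by positivity
    have h7 : C₁ * K ^ α₁ ≤ Cβ * K ^ |β| + C₁ * K ^ α₁ := by linarith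
    gcongr
  · have h1 := wh_rAnn_le_of_le hK hβcond (show n ≤ j + 1 by omega)
    have hnj' : (n : ℝ) ≤ j := by exact_mod_cast hnj
    rw [min_eq_left hnj', abs_sub_comm, abs_of_nonneg (by linarith : (0 : ℝ) ≤ j - n)]
    have h2 : wh ω (rAnn K n) * W⁻¹ ≤ Cβ * K ^ ((((j + 1 : ℕ) : ℝ) - n) * β) := by
      rw [← div_eq_mul_inv, div_le_iff₀ h0]
      exact h1
    calc wh ω (rAnn K n) * (W⁻¹ * K ^ (-(η * (j - (n : ℝ))) * q))
        ≤ Cβ * K ^ ((((j + 1 : ℕ) : ℝ) - n) * β) * K ^ (-(η * (j - (n : ℝ))) * q) := by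
          rw [← mul_assoc]
          gcongr
      _ = Cβ * K ^ (β - (η * q - β) * (j - n)) := by
          rw [mul_assoc, ← Real.rpow_add hK0]
          congr 2
          push_cast
          ring
      _ ≤ Cβ * K ^ (|β| - α * (j - n)) := by
          gcongr
          · exact hK.le
          · exact le_abs_self β
      _ = Cβ * K ^ |β| * K ^ (-(α * (j - n))) := by
          rw [mul_assoc, ← Real.rpow_add hK0]; congr 2
      _ ≤ _ := by
          gcongr
          have : 0 ≤ C₁ * K ^ α₁ := by positivity
          linarith

end Weights

section Annuli

variable {K : ℝ} {z : ℕ → ℂ}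

theorem exists_annIdx (hK : 1 < K) (hz : ∀ k, ‖z k‖ < 1) :
    ∃ J : ℕ → ℕ, ∀ k, annIdx K z (J k) k := by
  choose J hJ using fun k => exists_rAnn_le_lt hK (norm_nonneg (z k)) (hz k)
  exact ⟨J, hJ⟩

theorem tsum_mul_eq_tsum_annIdx (hK : 1 < K) {J : ℕ → ℕ} (hJ : ∀ k, annIdx K z (J k) k)
    (h g : ℕ → ℝ≥0∞) :
    ∑' k, h (J k) * g k =
      ∑' j, h j * ∑' k, Set.indicator {k' : ℕ | annIdx K z j k'} g k := by
  simp_rw [← ENNReal.tsum_mul_left]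
  rw [ENNReal.tsum_comm]
  refine tsum_congr fun k => ?_
  rw [tsum_eq_single (J k)]
  · rw [Set.indicator_of_mem (by exact hJ k)]
  · intro j hj
    rw [Set.indicator_of_notMem, mul_zero]
    intro hk
    exact hj (rAnn_index_unique hK hk (hJ k))

theorem rpow_min_le_ofReal (hK : 1 < K) {j k n : ℕ} (hk : annIdx K z j k) (hz : ‖z k‖ < 1)
    {r : ℝ} (hr : 0 ≤ r) (hn : (K ^ (n + 1))⁻¹ ≤ 1 - r) :
    ENNReal.ofReal K ^ (-(min (n : ℝ) j + 1)) ≤ ENNReal.ofReal (1 - ‖z k‖ * r) := by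
  have hK0 : 0 < K := by linarith
  have hr1 : r < 1 := by
    have : 0 < (K ^ (n + 1))⁻¹ := by positivity
    linarith
  have hk1 : (K ^ (j + 1))⁻¹ ≤ 1 - ‖z k‖ := by
    have := hk.2; rw [rAnn] at this; linarith
  have key : ∀ m : ℕ, (K ^ (m + 1))⁻¹ ≤ 1 - ‖z k‖ * r →
      ENNReal.ofReal K ^ (-((m : ℝ) + 1)) ≤ ENNReal.ofReal (1 - ‖z k‖ * r) := by
    intro m hm
    have := ofReal_inv_pow_eq hK0 (m + 1)
    push_cast at this
    rw [← this]
    exact ENNReal.ofReal_le_ofReal hm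
  rcases le_total n j with hnj | hnj
  · rw [min_eq_left (by exact_mod_cast hnj)]
    exact key n (by nlinarith [norm_nonneg (z k)])
  · rw [min_eq_right (by exact_mod_cast hnj)]
    exact key j (by nlinarith [norm_nonneg (z k)])

end Annuli

/-- The inner `ℓ^p`-norm of `Λ` over the annulus `A_j`. -/
def annNorm (p : ℝ≥0∞) (K : ℝ) (z : ℕ → ℂ) (Λ : ℕ → ℂ) (j : ℕ) : ℝ≥0∞ :=
  if p = ⊤ then
    ⨆ k : ℕ, Set.indicator {k' : ℕ | annIdx K z j k'} (fun k' => (‖Λ k'‖₊ : ℝ≥0∞)) k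
  else
    (∑' k : ℕ, Set.indicator {k' : ℕ | annIdx K z j k'}
      (fun k' => (‖Λ k'‖₊ : ℝ≥0∞) ^ p.toReal) k) ^ (p.toReal)⁻¹

theorem lpqNormE_eq (p : ℝ≥0∞) (q K : ℝ) (z Λ : ℕ → ℂ) :
    lpqNormE p q K z Λ = (∑' j, annNorm p K z Λ j ^ q) ^ q⁻¹ := rfl

theorem annNorm_top (K : ℝ) (z Λ : ℕ → ℂ) (j : ℕ) :
    annNorm ⊤ K z Λ j = ⨆ k : ℕ, Set.indicator {k' : ℕ | annIdx K z j k'} (fun k' => ‖Λ k'‖ₑ) k :=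
  if_pos rfl

theorem annNorm_rpow {p : ℝ≥0∞} (hp : 0 < p) (hpt : p ≠ ⊤) (K : ℝ) (z Λ : ℕ → ℂ) (j : ℕ) :
    annNorm p K z Λ j ^ p.toReal =
      ∑' k : ℕ, Set.indicator {k' : ℕ | annIdx K z j k'} (fun k' => ‖Λ k'‖ₑ ^ p.toReal) k := by
  have hP : 0 < p.toReal := ENNReal.toReal_pos hp.ne' hpt
  rw [annNorm, if_neg hpt, ← ENNReal.rpow_mul, inv_mul_cancel₀ hP.ne', ENNReal.rpow_one]
  rfl

theorem enorm_le_annNorm {p : ℝ≥0∞} (hp : 0 < p) {K : ℝ} {z : ℕ → ℂ} (Λ : ℕ → ℂ) {j k : ℕ}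
    (hk : annIdx K z j k) : ‖Λ k‖ₑ ≤ annNorm p K z Λ j := by
  by_cases hpt : p = ⊤
  · rw [hpt, annNorm_top]
    refine le_trans (le_of_eq ?_) (le_iSup _ k)
    rw [Set.indicator_of_mem (by exact hk)]
  · have hP : 0 < p.toReal := ENNReal.toReal_pos hp.ne' hpt
    rw [← ENNReal.rpow_le_rpow_iff hP, annNorm_rpow hp hpt]
    refine le_trans (le_of_eq ?_) (ENNReal.le_tsum k)
    rw [Set.indicator_of_mem (by exact hk)]

theorem annNorm_le_lpqNormE (p : ℝ≥0∞) {q : ℝ} (hq : 0 < q) (K : ℝ) (z Λ : ℕ → ℂ) (j : ℕ) :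
    annNorm p K z Λ j ≤ lpqNormE p q K z Λ := by
  rw [lpqNormE_eq, ENNReal.le_rpow_inv_iff hq]
  exact ENNReal.le_tsum j

theorem exists_rpow_tsum_dist_le {κ : ℝ≥0∞} (h1 : 1 < κ) (hκ : κ ≠ ⊤) {ε P q : ℝ} (hε : 0 < ε)
    (hP : 0 < P) (hq : 0 < q) :
    ∃ C : ℝ≥0∞, C ≠ ⊤ ∧ ∀ (n : ℕ) (X : ℕ → ℝ≥0∞),
      (∑' j, X j ^ P) ^ (q / P) ≤ C * ∑' j : ℕ, (κ ^ (ε * |(n : ℝ) - j|) * X j) ^ q := by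
  obtain ⟨C, hC, h⟩ := exists_tsum_rpow_dist_le h1 (mul_pos hε hP)
  have h0 : κ ≠ 0 := (zero_lt_one.trans h1).ne'
  refine ⟨C ^ (q / P), by finiteness, fun n X => ?_⟩
  have e : ∀ j : ℕ, X j ^ P =
      (κ ^ (ε * |(n : ℝ) - j|) * X j) ^ P * κ ^ (-(ε * P * |(n : ℝ) - j|)) := by
    intro j
    rw [ENNReal.mul_rpow_of_nonneg _ _ hP.le, ← ENNReal.rpow_mul, mul_right_comm,
      ← ENNReal.rpow_add _ _ h0 hκ]
    have : ε * |(n : ℝ) - j| * P + -(ε * P * |(n : ℝ) - j|) = 0 := by ring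
    rw [this, ENNReal.rpow_zero, one_mul]
  calc (∑' j, X j ^ P) ^ (q / P)
      = (∑' j : ℕ, (κ ^ (ε * |(n : ℝ) - j|) * X j) ^ P * κ ^ (-(ε * P * |(n : ℝ) - j|))) ^
          (q / P) := by
        congr 1
        exact tsum_congr e
    _ ≤ _ := rpow_tsum_mul_le _ _ (div_pos hq hP)
    _ ≤ C ^ (q / P) * ∑' j : ℕ, (κ ^ (ε * |(n : ℝ) - j|) * X j) ^ q := by
        gcongr ?_ * ?_
        · exact ENNReal.rpow_le_rpow (h n) (by positivity)
        · refine ENNReal.tsum_le_tsum fun j => ?_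
          rw [← ENNReal.rpow_mul, mul_div_cancel₀ _ hP.ne']

theorem norm_circ {r : ℝ} (hr : 0 ≤ r) (t : ℝ) : ‖circ r t‖ = r := by
  rw [circ, norm_mul, norm_exp_ofReal_mul_I, mul_one, Complex.norm_of_nonneg hr]

theorem ofReal_Mp_top_le {F : ℂ → ℂ} {r : ℝ} {B : ℝ≥0∞} (h : ∀ t, ‖F (circ r t)‖ₑ ≤ B) :
    ENNReal.ofReal (Mp ⊤ F r) ≤ B := by
  rw [Mp, if_pos rfl]
  rcases eq_or_ne B ⊤ with rfl | hB
  · exact le_top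
  · refine ENNReal.ofReal_le_of_le_toReal (Real.iSup_le (fun t => ?_) ENNReal.toReal_nonneg)
    rw [← toReal_enorm]
    exact ENNReal.toReal_mono hB (h t)

theorem ofReal_Mp_rpow_le {p : ℝ≥0∞} (hp : 0 < p) (hpt : p ≠ ⊤) (F : ℂ → ℂ) (r : ℝ) :
    ENNReal.ofReal (Mp p F r) ^ p.toReal ≤
      ∫⁻ t in Set.Ioc 0 (0 + 2 * π), ‖F (circ r t)‖ₑ ^ p.toReal := by
  have hP : 0 < p.toReal := ENNReal.toReal_pos hp.ne' hpt
  have hpi := Real.pi_gt_three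
  have hI : 0 ≤ ∫ t in (0:ℝ)..(2 * π), ‖F (circ r t)‖ ^ p.toReal :=
    intervalIntegral.integral_nonneg (by positivity) fun t _ => by positivity
  rw [Mp, if_neg hpt, ← ENNReal.ofReal_rpow_of_nonneg (by positivity) (by positivity),
    ← ENNReal.rpow_mul, inv_mul_cancel₀ hP.ne', ENNReal.rpow_one]
  have h1 : (2 * π)⁻¹ ≤ 1 := inv_le_one_of_one_le₀ (by linarith)
  refine (ENNReal.ofReal_le_ofReal (mul_le_of_le_one_left hI h1)).trans ?_
  rw [zero_add, intervalIntegral.integral_of_le (by positivity)]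
  refine (Real.ofReal_le_enorm _).trans ((enorm_integral_le_lintegral_enorm _).trans (le_of_eq ?_))
  refine lintegral_congr fun t => ?_
  rw [Real.enorm_rpow_of_nonneg (norm_nonneg _) hP.le, enorm_norm]

section Means

variable {K : ℝ} {z : ℕ → ℂ}

theorem enorm_one_sub_ne_zero {a w : ℂ} (ha : ‖a‖ < 1) (hw : ‖w‖ ≤ 1) :
    ‖1 - (starRingEnd ℂ) a * w‖ₑ ≠ 0 := by
  have := one_sub_norm_le_norm (a := a) hw
  rw [enorm_ne_zero, ← norm_pos_iff]
  linarith

theorem exists_Mp_rpow_le_of_ne_top (hK : 1 < K) (hz : ∀ k, ‖z k‖ < 1) (hsep : Separated z)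
    {J : ℕ → ℕ} (hJ : ∀ k, annIdx K z (J k) k)
    {p : ℝ≥0∞} (hp : 0 < p) (hpt : p ≠ ⊤) {M q ε : ℝ} (hq : 0 < q) (hε : 0 < ε)
    (hM : 1 + p⁻¹.toReal < M) :
    ∃ C : ℝ≥0∞, C ≠ ⊤ ∧ ∀ (Λ : ℕ → ℂ) (a B : ℕ → ℝ≥0∞) (F : ℂ → ℂ),
      (∀ k, a k ≤ ‖Λ k‖ₑ * B (J k) * ENNReal.ofReal K ^ (-((M - p⁻¹.toReal) * J k))) →
      (∀ w, ‖w‖ < 1 → ‖F w‖ₑ ≤ ∑' k, a k * ‖1 - (starRingEnd ℂ) (z k) * w‖ₑ ^ (-M)) →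
      ∀ (n : ℕ) (r : ℝ), 0 ≤ r → (K ^ (n + 1))⁻¹ ≤ 1 - r →
        ENNReal.ofReal (Mp p F r) ^ q ≤ C * ∑' j : ℕ,
          (ENNReal.ofReal K ^ (2 * ε * |(n : ℝ) - j|) * (annNorm p K z Λ j * (B j *
            ENNReal.ofReal K ^ (-((M - 1 - p⁻¹.toReal) * (j - min (n : ℝ) j)))))) ^ q := by
  have hK0 : 0 < K := by linarith
  set κ := ENNReal.ofReal K with hκ
  have hκ0 : κ ≠ 0 := by simpa [hκ] using hK0
  have hκt : κ ≠ ⊤ := ENNReal.ofReal_ne_top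
  have hκ1 : 1 < κ := by simpa [hκ] using hK
  set P := p.toReal with hPdef
  have hP : 0 < P := ENNReal.toReal_pos hp.ne' hpt
  rw [ENNReal.toReal_inv, ← hPdef] at *
  set η := M - 1 - P⁻¹ with hη
  have hη0 : 0 < η := by linarith
  set c₁ := P⁻¹ + η / 2 with hc₁
  set c₂ := 1 + η / 2 with hc₂
  have hc₁P : 1 < c₁ * P := by
    rw [hc₁, add_mul, inv_mul_cancel₀ hP.ne']
    have : 0 < η / 2 * P := by positivity
    linarith
  obtain ⟨C₂, hC₂, hdisc⟩ := hsep.exists_tsum_annIdx_le hz hK (c := c₂) (by linarith)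
  obtain ⟨C₃, hC₃, hdist⟩ := exists_tsum_rpow_dist_le hκ1 hε
  obtain ⟨C₄, hC₄, hcirc⟩ := exists_lintegral_circle_le hc₁P
  obtain ⟨C₅, hC₅, hpow⟩ := exists_rpow_tsum_dist_le hκ1 hκt hε hP hq
  refine ⟨((C₂ * C₃) ^ P * (C₄ * κ ^ (c₁ * P - 1))) ^ (q / P) * C₅, ?_,
    fun Λ a B F ha hF n r hr hn => ?_⟩
  · have h1 : (C₂ * C₃) ^ P ≠ ⊤ := by finiteness
    have h2 : C₄ * κ ^ (c₁ * P - 1) ≠ ⊤ := by finiteness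
    exact ENNReal.mul_ne_top (ENNReal.rpow_ne_top_of_nonneg (by positivity)
      (ENNReal.mul_ne_top h1 h2)) hC₅
  have hr1 : r < 1 := by
    have : 0 < (K ^ (n + 1))⁻¹ := by positivity
    linarith
  set m : ℕ → ℝ := fun j => min (n : ℝ) j with hm
  set y : ℕ → ℝ := fun j => ε * |(n : ℝ) - j| + j + (c₂ - 1) * m j with hy
  set x : ℕ → ℂ → ℝ≥0∞ := fun k w => ‖1 - (starRingEnd ℂ) (z k) * w‖ₑ with hx
  have hx0 : ∀ k w, ‖w‖ = r → x k w ≠ 0 := fun k w hw =>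
    enorm_one_sub_ne_zero (hz k) (hw.trans_le hr1.le)
  have hxt : ∀ k w, x k w ≠ ⊤ := fun k w => by simp [hx]
  have hsum : ∀ w, ‖w‖ = r → ∑' k, κ ^ (-y (J k)) * x k w ^ (-c₂) ≤ C₂ * C₃ := by
    intro w hw
    rw [tsum_mul_eq_tsum_annIdx hK hJ (fun j => κ ^ (-y j)) (fun k => x k w ^ (-c₂))]
    calc _ ≤ ∑' j : ℕ, C₂ * κ ^ (-(ε * |(n : ℝ) - j|)) := by
          refine ENNReal.tsum_le_tsum fun j => ?_
          calc _ ≤ κ ^ (-y j) * (C₂ * κ ^ ((j : ℝ) + (c₂ - 1) * min (n : ℝ) j)) := by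
                gcongr
                exact hdisc j n w (by rwa [hw])
            _ = C₂ * (κ ^ (-y j) * κ ^ ((j : ℝ) + (c₂ - 1) * min (n : ℝ) j)) := by ring
            _ = _ := by
                rw [← ENNReal.rpow_add _ _ hκ0 hκt]
                congr 2
                simp only [hy, hm]
                ring
      _ ≤ C₂ * C₃ := by
          rw [ENNReal.tsum_mul_left]
          gcongr
          exact hdist n
  have hFw : ∀ t, ‖F (circ r t)‖ₑ ^ P ≤ (C₂ * C₃) ^ P *
      ∑' k, (a k * κ ^ y (J k)) ^ P * x k (circ r t) ^ (-(c₁ * P)) := by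
    intro t
    have hw := norm_circ hr t
    set w := circ r t
    calc ‖F w‖ₑ ^ P ≤ (∑' k, a k * x k w ^ (-M)) ^ P := by
          gcongr
          exact hF w (hw.trans_lt hr1)
      _ = (∑' k, (a k * κ ^ y (J k) * x k w ^ (-c₁)) * (κ ^ (-y (J k)) * x k w ^ (-c₂))) ^ P := by
          congr 1
          refine tsum_congr fun k => ?_
          have e1 : x k w ^ (-M) = x k w ^ (-c₁) * x k w ^ (-c₂) := by
            rw [← ENNReal.rpow_add _ _ (hx0 k w hw) (hxt k w)]
            congr 1
            rw [hc₁, hc₂, hη]; ring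
          have e2 : κ ^ y (J k) * κ ^ (-y (J k)) = 1 := by
            rw [← ENNReal.rpow_add _ _ hκ0 hκt, add_neg_cancel, ENNReal.rpow_zero]
          calc a k * x k w ^ (-M) = a k * x k w ^ (-M) * (κ ^ y (J k) * κ ^ (-y (J k))) := by
                rw [e2, mul_one]
            _ = _ := by rw [e1]; ring
      _ ≤ (∑' k, κ ^ (-y (J k)) * x k w ^ (-c₂)) ^ P *
            ∑' k, (a k * κ ^ y (J k) * x k w ^ (-c₁)) ^ P := rpow_tsum_mul_le _ _ hP
      _ ≤ _ := by
          gcongr ?_ ^ P * ?_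
          · exact hsum w hw
          · refine ENNReal.tsum_le_tsum fun k => ?_
            rw [ENNReal.mul_rpow_of_nonneg _ _ hP.le, ← ENNReal.rpow_mul (x k w), neg_mul]
  set X : ℕ → ℝ≥0∞ := fun j => κ ^ (ε * |(n : ℝ) - j|) * (annNorm p K z Λ j * (B j *
            κ ^ (-(η * (j - min (n : ℝ) j))))) with hX
  have hxm : ∀ k, Measurable fun t => x k (circ r t) ^ (-(c₁ * P)) := by
    intro k
    simp only [hx, circ]
    fun_prop
  have hint : ∀ k, ∫⁻ t in Set.Ioc 0 (0 + 2 * π), x k (circ r t) ^ (-(c₁ * P)) ≤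
      C₄ * κ ^ (c₁ * P - 1) * κ ^ ((c₁ * P - 1) * m (J k)) := by
    intro k
    have hnk : ‖(starRingEnd ℂ) (z k) * r‖ = ‖z k‖ * r := by
      rw [norm_mul, RCLike.norm_conj, Complex.norm_of_nonneg hr]
    have h1 := hcirc ((starRingEnd ℂ) (z k) * r) (by
      rw [hnk]; nlinarith [hz k, norm_nonneg (z k)]) 0
    rw [hnk] at h1
    have h2 : ∫⁻ t in Set.Ioc 0 (0 + 2 * π), x k (circ r t) ^ (-(c₁ * P)) =
        ∫⁻ t in Set.Ioc 0 (0 + 2 * π),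
          ‖1 - (starRingEnd ℂ) (z k) * r * exp (t * I)‖ₑ ^ (-(c₁ * P)) := by
      simp only [hx, circ, mul_assoc]
    rw [h2]
    refine h1.trans ?_
    rw [mul_assoc]
    gcongr
    refine (ennreal_rpow_le_rpow_of_nonpos (by linarith)
      (rpow_min_le_ofReal hK (hJ k) (hz k) hr hn)).trans (le_of_eq ?_)
    rw [← hκ, ← ENNReal.rpow_mul, ← ENNReal.rpow_add _ _ hκ0 hκt]
    congr 1
    simp only [hm]
    ring
  have hmean : ENNReal.ofReal (Mp p F r) ^ P ≤
      (C₂ * C₃) ^ P * (C₄ * κ ^ (c₁ * P - 1)) * ∑' j, X j ^ P := by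
    calc ENNReal.ofReal (Mp p F r) ^ P
        ≤ ∫⁻ t in Set.Ioc 0 (0 + 2 * π), ‖F (circ r t)‖ₑ ^ P := ofReal_Mp_rpow_le hp hpt F r
      _ ≤ ∫⁻ t in Set.Ioc 0 (0 + 2 * π), (C₂ * C₃) ^ P *
            ∑' k, (a k * κ ^ y (J k)) ^ P * x k (circ r t) ^ (-(c₁ * P)) := lintegral_mono hFw
      _ = (C₂ * C₃) ^ P * ∑' k, (a k * κ ^ y (J k)) ^ P *
            ∫⁻ t in Set.Ioc 0 (0 + 2 * π), x k (circ r t) ^ (-(c₁ * P)) := by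
          rw [lintegral_const_mul' _ _ (by finiteness), lintegral_tsum
            (fun k => ((hxm k).const_mul _).aemeasurable)]
          congr 1
          exact tsum_congr fun k => lintegral_const_mul _ (hxm k)
      _ ≤ (C₂ * C₃) ^ P * ∑' k, (C₄ * κ ^ (c₁ * P - 1)) *
            ((B (J k) * κ ^ (ε * |(n : ℝ) - J k| - η * (J k - m (J k)))) ^ P * ‖Λ k‖ₑ ^ P) := by
          refine mul_le_mul' le_rfl (ENNReal.tsum_le_tsum fun k => ?_)
          calc _ ≤ ((‖Λ k‖ₑ * B (J k) * κ ^ (-((M - P⁻¹) * J k))) * κ ^ y (J k)) ^ P *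
                (C₄ * κ ^ (c₁ * P - 1) * κ ^ ((c₁ * P - 1) * m (J k))) := by
                gcongr
                · exact ha k
                · exact hint k
            _ = (C₄ * κ ^ (c₁ * P - 1)) * (B (J k) ^ P * (κ ^ (-((M - P⁻¹) * J k) * P) *
                  κ ^ (y (J k) * P) * κ ^ ((c₁ * P - 1) * m (J k))) * ‖Λ k‖ₑ ^ P) := by
                simp only [ENNReal.mul_rpow_of_nonneg _ _ hP.le, ← ENNReal.rpow_mul]
                ring
            _ = _ := by
                rw [← ENNReal.rpow_add _ _ hκ0 hκt, ← ENNReal.rpow_add _ _ hκ0 hκt,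
                  ENNReal.mul_rpow_of_nonneg _ _ hP.le, ← ENNReal.rpow_mul]
                congr 5
                simp only [hy, hc₁, hc₂, hη]
                field_simp
                ring
      _ = (C₂ * C₃) ^ P * (C₄ * κ ^ (c₁ * P - 1)) * ∑' j, X j ^ P := by
          rw [ENNReal.tsum_mul_left, mul_assoc ((C₂ * C₃) ^ P)]
          congr 2
          rw [tsum_mul_eq_tsum_annIdx hK hJ
            (fun j => (B j * κ ^ (ε * |(n : ℝ) - j| - η * (j - m j))) ^ P)
            (fun k => ‖Λ k‖ₑ ^ P)]
          refine tsum_congr fun j => ?_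
          rw [← annNorm_rpow hp hpt, ← ENNReal.mul_rpow_of_nonneg _ _ hP.le, hX]
          congr 1
          rw [sub_eq_add_neg, ENNReal.rpow_add _ _ hκ0 hκt]
          ring
  have hfin : ENNReal.ofReal (Mp p F r) ^ q = (ENNReal.ofReal (Mp p F r) ^ P) ^ (q / P) := by
    rw [← ENNReal.rpow_mul, mul_div_cancel₀ _ hP.ne']
  rw [hfin]
  refine (ENNReal.rpow_le_rpow hmean (by positivity)).trans ?_
  rw [ENNReal.mul_rpow_of_nonneg _ _ (by positivity), mul_assoc]
  refine mul_le_mul' le_rfl ((hpow n X).trans (le_of_eq ?_))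
  congr 1
  refine tsum_congr fun j => ?_
  rw [hX, ← mul_assoc, ← ENNReal.rpow_add _ _ hκ0 hκt]
  congr 3
  ring

theorem exists_Mp_rpow_le_top (hK : 1 < K) (hz : ∀ k, ‖z k‖ < 1) (hsep : Separated z)
    {J : ℕ → ℕ} (hJ : ∀ k, annIdx K z (J k) k)
    {M q ε : ℝ} (hq : 0 < q) (hε : 0 < ε) (hM : 1 < M) :
    ∃ C : ℝ≥0∞, C ≠ ⊤ ∧ ∀ (Λ : ℕ → ℂ) (a B : ℕ → ℝ≥0∞) (F : ℂ → ℂ),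
      (∀ k, a k ≤ ‖Λ k‖ₑ * B (J k) * ENNReal.ofReal K ^ (-(M * J k))) →
      (∀ w, ‖w‖ < 1 → ‖F w‖ₑ ≤ ∑' k, a k * ‖1 - (starRingEnd ℂ) (z k) * w‖ₑ ^ (-M)) →
      ∀ (n : ℕ) (r : ℝ), 0 ≤ r → (K ^ (n + 1))⁻¹ ≤ 1 - r →
        ENNReal.ofReal (Mp ⊤ F r) ^ q ≤ C * ∑' j : ℕ,
          (ENNReal.ofReal K ^ (ε * |(n : ℝ) - j|) * (annNorm ⊤ K z Λ j * (B j *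
            ENNReal.ofReal K ^ (-((M - 1) * (j - min (n : ℝ) j)))))) ^ q := by
  have hK0 : 0 < K := by linarith
  set κ := ENNReal.ofReal K with hκ
  have hκ0 : κ ≠ 0 := by simpa [hκ] using hK0
  have hκt : κ ≠ ⊤ := ENNReal.ofReal_ne_top
  have hκ1 : 1 < κ := by simpa [hκ] using hK
  obtain ⟨C₂, hC₂, hdisc⟩ := hsep.exists_tsum_annIdx_le hz hK hM
  obtain ⟨C₅, hC₅, hpow⟩ := exists_rpow_tsum_dist_le hκ1 hκt hε one_pos hq
  simp only [ENNReal.rpow_one, div_one] at hpow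
  refine ⟨C₂ ^ q * C₅, by finiteness, fun Λ a B F ha hF n r hr hn => ?_⟩
  have hr1 : r < 1 := by
    have : 0 < (K ^ (n + 1))⁻¹ := by positivity
    linarith
  set X : ℕ → ℝ≥0∞ := fun j => annNorm ⊤ K z Λ j * (B j *
            κ ^ (-((M - 1) * (j - min (n : ℝ) j)))) with hX
  have hmean : ENNReal.ofReal (Mp ⊤ F r) ≤ C₂ * ∑' j, X j := by
    refine ofReal_Mp_top_le fun t => ?_
    have hw := norm_circ hr t
    set w := circ r t
    calc ‖F w‖ₑ ≤ ∑' k, a k * ‖1 - (starRingEnd ℂ) (z k) * w‖ₑ ^ (-M) :=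
          hF w (hw.trans_lt hr1)
      _ ≤ ∑' k, (annNorm ⊤ K z Λ (J k) * B (J k) * κ ^ (-(M * J k))) *
            ‖1 - (starRingEnd ℂ) (z k) * w‖ₑ ^ (-M) := by
          refine ENNReal.tsum_le_tsum fun k => ?_
          gcongr
          refine (ha k).trans ?_
          gcongr
          exact enorm_le_annNorm (by simp) Λ (hJ k)
      _ = _ := tsum_mul_eq_tsum_annIdx hK hJ
            (fun j => annNorm ⊤ K z Λ j * B j * κ ^ (-(M * j)))
            (fun k => ‖1 - (starRingEnd ℂ) (z k) * w‖ₑ ^ (-M))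
      _ ≤ ∑' j, C₂ * X j := by
          refine ENNReal.tsum_le_tsum fun j => ?_
          calc _ ≤ annNorm ⊤ K z Λ j * B j * κ ^ (-(M * j)) *
                (C₂ * κ ^ ((j : ℝ) + (M - 1) * min (n : ℝ) j)) := by
                gcongr
                exact hdisc j n w (by rwa [hw])
            _ = C₂ * (annNorm ⊤ K z Λ j * (B j * (κ ^ (-(M * j)) *
                  κ ^ ((j : ℝ) + (M - 1) * min (n : ℝ) j)))) := by ring
            _ = C₂ * X j := by
                rw [← ENNReal.rpow_add _ _ hκ0 hκt, hX]
                congr 4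
                ring
      _ = _ := ENNReal.tsum_mul_left
  refine (ENNReal.rpow_le_rpow hmean hq.le).trans ?_
  rw [ENNReal.mul_rpow_of_nonneg _ _ hq.le, mul_assoc]
  gcongr
  exact hpow n X

end Means

section Synthesis

variable {K : ℝ} {z : ℕ → ℂ}

/-- The integral means of the atomic series on the `n`-th annulus, in terms of the norms of the
coefficients over each annulus, up to a loss `K^{2ε|n-j|}`. -/
theorem exists_Mp_rpow_le (hK : 1 < K) (hz : ∀ k, ‖z k‖ < 1) (hsep : Separated z)
    {J : ℕ → ℕ} (hJ : ∀ k, annIdx K z (J k) k)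
    {p : ℝ≥0∞} (hp : 0 < p) {M q ε : ℝ} (hq : 0 < q) (hε : 0 < ε)
    (hM : 1 + p⁻¹.toReal < M) :
    ∃ C : ℝ≥0∞, C ≠ ⊤ ∧ ∀ (Λ : ℕ → ℂ) (a B : ℕ → ℝ≥0∞) (F : ℂ → ℂ),
      (∀ k, a k ≤ ‖Λ k‖ₑ * B (J k) * ENNReal.ofReal K ^ (-((M - p⁻¹.toReal) * J k))) →
      (∀ w, ‖w‖ < 1 → ‖F w‖ₑ ≤ ∑' k, a k * ‖1 - (starRingEnd ℂ) (z k) * w‖ₑ ^ (-M)) →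
      ∀ (n : ℕ) (r : ℝ), 0 ≤ r → (K ^ (n + 1))⁻¹ ≤ 1 - r →
        ENNReal.ofReal (Mp p F r) ^ q ≤ C * ∑' j : ℕ,
          (ENNReal.ofReal K ^ (2 * ε * |(n : ℝ) - j|) * (annNorm p K z Λ j * (B j *
            ENNReal.ofReal K ^ (-((M - 1 - p⁻¹.toReal) * (j - min (n : ℝ) j)))))) ^ q := by
  by_cases hpt : p = ⊤
  · subst hpt
    simp only [ENNReal.inv_top, ENNReal.toReal_zero, sub_zero, add_zero] at hM ⊢
    exact exists_Mp_rpow_le_top hK hz hsep hJ hq (by positivity) hM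
  · exact exists_Mp_rpow_le_of_ne_top hK hz hsep hJ hp hpt hq hε hM

variable {ω : ℝ → ℝ} {p : ℝ≥0∞} {M q β Cβ : ℝ}

theorem ApqNormE_rpow (hq : 0 < q) (F : ℂ → ℂ) :
    ApqNormE p q ω F ^ q =
      ∫⁻ r in Set.Ioo (0:ℝ) 1, ENNReal.ofReal (Mp p F r) ^ q * ENNReal.ofReal (ω r) := by
  rw [ApqNormE, ← ENNReal.rpow_mul, inv_mul_cancel₀ hq.ne', ENNReal.rpow_one]

theorem RadialWeight.ApqNormE_rpow_le_tsum (hω : RadialWeight ω) (hK : 1 < K) (hq : 0 < q)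
    {F : ℂ → ℂ} {D : ℕ → ℝ≥0∞}
    (hD : ∀ (n : ℕ) (r : ℝ), 0 ≤ r → (K ^ (n + 1))⁻¹ ≤ 1 - r →
      ENNReal.ofReal (Mp p F r) ^ q ≤ D n) :
    ApqNormE p q ω F ^ q ≤ ∑' n, D n * ENNReal.ofReal (wh ω (rAnn K n)) := by
  have hcover : Set.Ioo (0:ℝ) 1 ⊆ ⋃ n : ℕ, Set.Ico (rAnn K n) (rAnn K (n + 1)) := fun x hx =>
    Set.mem_iUnion.2 (exists_rAnn_le_lt hK hx.1.le hx.2)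
  rw [ApqNormE_rpow hq]
  refine (lintegral_mono_set hcover).trans ((lintegral_iUnion_le _ _).trans
    (ENNReal.tsum_le_tsum fun n => ?_))
  have hsub : rAnn K n ≤ rAnn K (n + 1) := rAnn_mono hK n.le_succ
  calc _ ≤ ∫⁻ r in Set.Ico (rAnn K n) (rAnn K (n + 1)), D n * ENNReal.ofReal (ω r) := by
        refine setLIntegral_mono' measurableSet_Ico fun r hr => ?_
        gcongr
        refine hD n r ((rAnn_nonneg hK n).trans hr.1) ?_
        rw [← one_sub_rAnn]
        linarith [hr.2]
    _ = D n * ∫⁻ r in Set.Ico (rAnn K n) (rAnn K (n + 1)), ENNReal.ofReal (ω r) := by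
        refine lintegral_const_mul'' _ ?_
        have : IntegrableOn ω (Set.Ioc (rAnn K n) (rAnn K (n + 1))) :=
          (intervalIntegrable_iff_integrableOn_Ioc_of_le hsub).1
            (hω.intervalIntegrable (rAnn_nonneg hK n) hsub (rAnn_lt_one hK _).le)
        rw [Measure.restrict_congr_set Ico_ae_eq_Ioc]
        exact this.aestronglyMeasurable.aemeasurable.ennreal_ofReal
    _ ≤ _ := by
        gcongr
        exact hω.setLIntegral_le (rAnn_nonneg hK n) hsub (rAnn_lt_one hK _).le

/-- The norm estimate for functions dominated by an atomic series. -/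
theorem exists_ApqNormE_le (hω : RadialWeight ω) (hD : Dcheck ω) (hK : 1 < K) (hCβ : 0 < Cβ)
    (hβcond : ∀ r t : ℝ, 0 ≤ r → r ≤ t → t < 1 →
      wh ω r ≤ Cβ * ((1 - r) / (1 - t)) ^ β * wh ω t)
    (hz : ∀ k, ‖z k‖ < 1) (hsep : Separated z)
    {J : ℕ → ℕ} (hJ : ∀ k, annIdx K z (J k) k) (hp : 0 < p) (hq : 0 < q) (hβ : 0 < β)
    (hM : 1 + p⁻¹.toReal + β / q < M) :
    ∃ C : ℝ≥0∞, C ≠ ⊤ ∧ ∀ (Λ : ℕ → ℂ) (a : ℕ → ℝ≥0∞) (F : ℂ → ℂ),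
      (∀ k, a k ≤ ‖Λ k‖ₑ * ENNReal.ofReal (wh ω (rAnn K (J k + 1)) ^ (-(1 / q))) *
        ENNReal.ofReal K ^ (-((M - p⁻¹.toReal) * J k))) →
      (∀ w, ‖w‖ < 1 → ‖F w‖ₑ ≤ ∑' k, a k * ‖1 - (starRingEnd ℂ) (z k) * w‖ₑ ^ (-M)) →
      ApqNormE p q ω F ≤ C * lpqNormE p q K z Λ := by
  set κ := ENNReal.ofReal K with hκ
  have hκ0 : κ ≠ 0 := by simpa [hκ] using zero_lt_one.trans hK
  have hκt : κ ≠ ⊤ := ENNReal.ofReal_ne_top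
  have hκ1 : 1 < κ := by simpa [hκ] using hK
  have hβq : 0 < β / q := by positivity
  obtain ⟨α, hα, C₁, hC₁, hratio⟩ := exists_wh_ratio_le hω hD hK hCβ hβcond hq
    (show β / q < M - 1 - p⁻¹.toReal by linarith)
  obtain ⟨C₂, hC₂, hmean⟩ := exists_Mp_rpow_le hK hz hsep hJ hp hq
    (show 0 < α / (4 * q) by positivity) (show 1 + p⁻¹.toReal < M by linarith)
  obtain ⟨C₃, hC₃, hdist⟩ := exists_tsum_rpow_dist_le hκ1 (half_pos hα)
  refine ⟨(C₂ * (C₁ * C₃)) ^ q⁻¹, ENNReal.rpow_ne_top_of_nonneg (by positivity)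
    (by finiteness), fun Λ a F ha hF => ?_⟩
  rw [lpqNormE_eq, ← ENNReal.mul_rpow_of_nonneg _ _ (inv_nonneg.2 hq.le),
    ENNReal.le_rpow_inv_iff hq]
  refine (hω.ApqNormE_rpow_le_tsum hK hq
    (hmean Λ a (fun j => ENNReal.ofReal (wh ω (rAnn K (j + 1)) ^ (-(1 / q)))) F ha hF)).trans ?_
  calc _ ≤ ∑' n : ℕ, C₂ * ∑' j : ℕ,
        C₁ * (annNorm p K z Λ j ^ q * κ ^ (-(α / 2 * |(n : ℝ) - j|))) := by
        refine ENNReal.tsum_le_tsum fun n => ?_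
        rw [mul_assoc, ← ENNReal.tsum_mul_right]
        refine mul_le_mul' le_rfl (ENNReal.tsum_le_tsum fun j => ?_)
        have h := hratio n j
        rw [ENNReal.mul_rpow_of_nonneg _ _ hq.le, ENNReal.mul_rpow_of_nonneg _ _ hq.le]
        calc _ = κ ^ (2 * (α / (4 * q)) * |(n : ℝ) - j| * q) * annNorm p K z Λ j ^ q *
              (ENNReal.ofReal (wh ω (rAnn K n)) *
                (ENNReal.ofReal (wh ω (rAnn K (j + 1)) ^ (-(1 / q))) *
                  κ ^ (-((M - 1 - p⁻¹.toReal) * (j - min (n : ℝ) j)))) ^ q) := by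
              rw [ENNReal.rpow_mul _ _ q]
              ring
          _ ≤ κ ^ (2 * (α / (4 * q)) * |(n : ℝ) - j| * q) * annNorm p K z Λ j ^ q *
              (C₁ * κ ^ (-(α * |(n : ℝ) - j|))) := by gcongr
          _ = C₁ * (annNorm p K z Λ j ^ q * (κ ^ (2 * (α / (4 * q)) * |(n : ℝ) - j| * q) *
              κ ^ (-(α * |(n : ℝ) - j|)))) := by ring
          _ = _ := by
              rw [← ENNReal.rpow_add _ _ hκ0 hκt]
              congr 3
              field_simp
              ring
    _ = C₂ * (C₁ * ∑' j : ℕ, annNorm p K z Λ j ^ q *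
          ∑' n : ℕ, κ ^ (-(α / 2 * |(j : ℝ) - n|))) := by
        rw [ENNReal.tsum_mul_left, ENNReal.tsum_comm]
        simp_rw [ENNReal.tsum_mul_left, abs_sub_comm]
    _ ≤ C₂ * (C₁ * ∑' j : ℕ, annNorm p K z Λ j ^ q * C₃) := by
        gcongr with j
        exact hdist j
    _ = _ := by
        rw [ENNReal.tsum_mul_right]
        ring

/-- The absolute value of the coefficient of the `k`-th atom. -/
def atomCoeff (p : ℝ≥0∞) (q : ℝ) (ω : ℝ → ℝ) (M : ℝ) (z Λ : ℕ → ℂ) (k : ℕ) : ℝ≥0∞ :=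
  ‖Λ k‖ₑ * ENNReal.ofReal ((1 - ‖z k‖) ^ (M - p⁻¹.toReal) * wh ω ‖z k‖ ^ (-(1 / q)))

theorem atomCoeff_le (hω : RadialWeight ω) (hK : 1 < K)
    (hβcond : ∀ r t : ℝ, 0 ≤ r → r ≤ t → t < 1 →
      wh ω r ≤ Cβ * ((1 - r) / (1 - t)) ^ β * wh ω t) (hq : 0 < q)
    (hz : ∀ k, ‖z k‖ < 1) (hM : p⁻¹.toReal ≤ M) (Λ : ℕ → ℂ) {j k : ℕ} (hk : annIdx K z j k) :
    atomCoeff p q ω M z Λ k ≤ ‖Λ k‖ₑ * ENNReal.ofReal (wh ω (rAnn K (j + 1)) ^ (-(1 / q))) *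
      ENNReal.ofReal K ^ (-((M - p⁻¹.toReal) * j)) := by
  have h1 : 1 - ‖z k‖ ≤ (K ^ j)⁻¹ := by
    rw [← one_sub_rAnn]
    linarith [hk.1]
  have h0 : 0 ≤ 1 - ‖z k‖ := by linarith [hz k]
  have hM' : 0 ≤ M - p⁻¹.toReal := by linarith
  rw [atomCoeff, ENNReal.ofReal_mul (by positivity), mul_assoc,
    mul_comm (ENNReal.ofReal ((1 - ‖z k‖) ^ _))]
  refine mul_le_mul' le_rfl (mul_le_mul' (ENNReal.ofReal_le_ofReal ?_) ?_)
  · exact wh_rpow_le_of_annIdx hω hK hβcond hq (norm_nonneg _) hk.2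
  · rw [← ENNReal.ofReal_rpow_of_nonneg h0 hM', ← neg_mul, mul_comm, ← neg_mul_comm,
      mul_comm, mul_comm _ (-(j : ℝ)), ENNReal.rpow_mul, ← ofReal_inv_pow_eq (by linarith)]
    gcongr

theorem tsum_atomCoeff_ne_top (hω : RadialWeight ω) (hK : 1 < K) (hCβ : 0 < Cβ)
    (hβcond : ∀ r t : ℝ, 0 ≤ r → r ≤ t → t < 1 →
      wh ω r ≤ Cβ * ((1 - r) / (1 - t)) ^ β * wh ω t)
    (hz : ∀ k, ‖z k‖ < 1) (hsep : Separated z) (hp : 0 < p) (hq : 0 < q) (hβ : 0 < β)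
    (hM : 1 + p⁻¹.toReal + β / q < M) {Λ : ℕ → ℂ} (hΛ : lpqNormE p q K z Λ ≠ ⊤) :
    ∑' k, atomCoeff p q ω M z Λ k ≠ ⊤ := by
  have hK0 : 0 < K := by linarith
  set κ := ENNReal.ofReal K with hκ
  have hκ0 : κ ≠ 0 := by simpa [hκ] using hK0
  have hκt : κ ≠ ⊤ := ENNReal.ofReal_ne_top
  have hκ1 : 1 < κ := by simpa [hκ] using hK
  have hβq : 0 < β / q := by positivity
  obtain ⟨J, hJ⟩ := exists_annIdx hK hz
  obtain ⟨C₁, hC₁, hwh⟩ := exists_wh_rAnn_rpow_le hω hK hCβ hβcond hq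
  obtain ⟨C₂, hC₂, hcount⟩ := hsep.exists_tsum_annIdx_le hz hK one_lt_two
  obtain ⟨C₃, hC₃, hdist⟩ := exists_tsum_rpow_dist_le hκ1
    (show 0 < M - p⁻¹.toReal - 1 - β / q by linarith)
  set N := lpqNormE p q K z Λ
  set b : ℕ → ℝ≥0∞ := fun j => ENNReal.ofReal (wh ω (rAnn K (j + 1)) ^ (-(1 / q))) *
    κ ^ (-((M - p⁻¹.toReal) * j)) with hb
  have hcount0 : ∀ j : ℕ,
      ∑' k, Set.indicator {k' : ℕ | annIdx K z j k'} (fun _ => (1 : ℝ≥0∞)) k ≤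
        C₂ * κ ^ (j : ℝ) := by
    intro j
    have h := hcount j 0 0 (by
      rw [norm_zero, sub_zero]
      exact inv_le_one_of_one_le₀ (one_le_pow₀ hK.le))
    simpa using h
  have hle : ∑' k, atomCoeff p q ω M z Λ k ≤ N * (ENNReal.ofReal C₁ * C₂ * C₃) := by
    calc ∑' k, atomCoeff p q ω M z Λ k ≤ ∑' k, N * (b (J k) * 1) := by
          refine ENNReal.tsum_le_tsum fun k => ?_
          refine (atomCoeff_le hω hK hβcond hq hz (by linarith) Λ (hJ k)).trans ?_
          rw [mul_assoc, mul_one]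
          exact mul_le_mul' ((enorm_le_annNorm hp Λ (hJ k)).trans
            (annNorm_le_lpqNormE p hq K z Λ _)) le_rfl
      _ = N * ∑' j, b j *
            ∑' k, Set.indicator {k' : ℕ | annIdx K z j k'} (fun _ => (1 : ℝ≥0∞)) k := by
          rw [ENNReal.tsum_mul_left, tsum_mul_eq_tsum_annIdx hK hJ b fun _ => 1]
      _ ≤ N * ∑' j : ℕ, ENNReal.ofReal C₁ * C₂ *
            κ ^ (-((M - p⁻¹.toReal - 1 - β / q) * |((0 : ℕ) : ℝ) - j|)) := by
          refine mul_le_mul' le_rfl (ENNReal.tsum_le_tsum fun j => ?_)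
          have h1 : ENNReal.ofReal (wh ω (rAnn K (j + 1)) ^ (-(1 / q))) ≤
              ENNReal.ofReal C₁ * κ ^ (β / q * j) := by
            refine (ENNReal.ofReal_le_ofReal (hwh j)).trans (le_of_eq ?_)
            rw [ENNReal.ofReal_mul hC₁.le, ENNReal.ofReal_rpow_of_pos hK0]
          calc _ ≤ ENNReal.ofReal C₁ * κ ^ (β / q * j) * κ ^ (-((M - p⁻¹.toReal) * j)) *
                (C₂ * κ ^ (j : ℝ)) := by
                gcongr
                · exact mul_le_mul' h1 le_rfl
                · exact hcount0 j
            _ = ENNReal.ofReal C₁ * C₂ *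
                (κ ^ (β / q * j) * κ ^ (-((M - p⁻¹.toReal) * j)) * κ ^ (j : ℝ)) := by ring
            _ = _ := by
                rw [← ENNReal.rpow_add _ _ hκ0 hκt, ← ENNReal.rpow_add _ _ hκ0 hκt]
                congr 2
                rw [Nat.cast_zero, zero_sub, abs_neg, Nat.abs_cast]
                ring
      _ ≤ _ := by
          rw [ENNReal.tsum_mul_left]
          gcongr
          exact hdist 0
  exact ne_top_of_le_ne_top (by finiteness) hle

end Synthesis

section Convergence

/-- The `k`-th term of the atomic series. -/
def atom (p : ℝ≥0∞) (q : ℝ) (ω : ℝ → ℝ) (M : ℝ) (z Λ : ℕ → ℂ) (k : ℕ) (w : ℂ) : ℂ :=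
  Λ k * (((1 - ‖z k‖) ^ (M - p⁻¹.toReal) * (wh ω ‖z k‖) ^ (-(1/q)) : ℝ) : ℂ) /
    (1 - (starRingEnd ℂ) (z k) * w) ^ (M : ℂ)

variable {ω : ℝ → ℝ} {p : ℝ≥0∞} {M q : ℝ} {z Λ : ℕ → ℂ}

theorem norm_one_sub_pos {a w : ℂ} (ha : ‖a‖ < 1) (hw : ‖w‖ ≤ 1) :
    0 < ‖1 - (starRingEnd ℂ) a * w‖ := by
  have := one_sub_norm_le_norm (a := a) hw
  linarith

theorem one_sub_mem_slitPlane {a w : ℂ} (ha : ‖a‖ < 1) (hw : ‖w‖ ≤ 1) :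
    1 - (starRingEnd ℂ) a * w ∈ slitPlane := by
  refine Or.inl ?_
  have h1 : ‖(starRingEnd ℂ) a * w‖ < 1 := by
    rw [norm_mul, RCLike.norm_conj]
    nlinarith [norm_nonneg a, norm_nonneg w]
  have h2 := re_le_norm ((starRingEnd ℂ) a * w)
  rw [sub_re, one_re]
  linarith

theorem enorm_atom (hω : RadialWeight ω) (hz : ∀ k, ‖z k‖ < 1) (k : ℕ) {w : ℂ} (hw : ‖w‖ ≤ 1) :
    ‖atom p q ω M z Λ k w‖ₑ =
      atomCoeff p q ω M z Λ k * ‖1 - (starRingEnd ℂ) (z k) * w‖ₑ ^ (-M) := by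
  have hpos := norm_one_sub_pos (hz k) hw
  have h0 : 0 ≤ 1 - ‖z k‖ := by linarith [hz k]
  have hwh := hω.wh_nonneg (hz k).le
  rw [atom, div_eq_mul_inv, ← cpow_neg, enorm_mul, enorm_mul, atomCoeff]
  congr 1
  · congr 1
    rw [← ofReal_norm, Complex.norm_of_nonneg (by positivity)]
  · rw [← ofReal_norm, ← ofReal_norm, ENNReal.ofReal_rpow_of_pos hpos, ← ofReal_neg,
      norm_cpow_real]

theorem norm_atom_le (hω : RadialWeight ω) (hM : 0 ≤ M) (hz : ∀ k, ‖z k‖ < 1) {R : ℝ} (hR : R < 1)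
    (k : ℕ) {w : ℂ} (hw : ‖w‖ ≤ R) :
    ‖atom p q ω M z Λ k w‖ ≤ (atomCoeff p q ω M z Λ k).toReal * (1 - R) ^ (-M) := by
  have h1 : 1 - R ≤ ‖1 - (starRingEnd ℂ) (z k) * w‖ := by
    have := norm_sub_norm_le (1 : ℂ) ((starRingEnd ℂ) (z k) * w)
    rw [norm_one, norm_mul, RCLike.norm_conj] at this
    nlinarith [norm_nonneg w, hz k]
  rw [← toReal_enorm, enorm_atom hω hz k (hw.trans hR.le), ENNReal.toReal_mul,
    ← ENNReal.toReal_rpow, toReal_enorm]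
  exact mul_le_mul_of_nonneg_left
    (Real.rpow_le_rpow_of_nonpos (sub_pos.2 hR) h1 (neg_nonpos.2 hM)) ENNReal.toReal_nonneg

theorem differentiableOn_atom (hz : ∀ k, ‖z k‖ < 1) (k : ℕ) :
    DifferentiableOn ℂ (atom p q ω M z Λ k) (Metric.ball 0 1) := by
  intro w hw
  have hw' : ‖w‖ ≤ 1 := (mem_ball_zero_iff.1 hw).le
  have hs := one_sub_mem_slitPlane (hz k) hw'
  have hd : DifferentiableAt ℂ (fun w => (1 - (starRingEnd ℂ) (z k) * w) ^ (M : ℂ)) w :=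
    DifferentiableAt.cpow_const (by fun_prop) hs
  have hne : (1 - (starRingEnd ℂ) (z k) * w) ^ (M : ℂ) ≠ 0 := by
    rw [cpow_ne_zero_iff]
    exact Or.inl (slitPlane_ne_zero hs)
  exact (DifferentiableAt.div (differentiableAt_const _) hd hne).differentiableWithinAt

theorem summable_atom (hω : RadialWeight ω) (hM : 0 ≤ M) (hz : ∀ k, ‖z k‖ < 1)
    (hs : ∑' k, atomCoeff p q ω M z Λ k ≠ ⊤) {w : ℂ} (hw : ‖w‖ < 1) :
    Summable fun k => atom p q ω M z Λ k w :=
  Summable.of_norm_bounded ((ENNReal.summable_toReal hs).mul_right _)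
    fun k => norm_atom_le hω hM hz hw k le_rfl

theorem differentiableOn_tsum_atom (hω : RadialWeight ω) (hM : 0 ≤ M) (hz : ∀ k, ‖z k‖ < 1)
    (hs : ∑' k, atomCoeff p q ω M z Λ k ≠ ⊤) :
    DifferentiableOn ℂ (fun w => ∑' k, atom p q ω M z Λ k w) (Metric.ball 0 1) := by
  intro w hw
  obtain ⟨R, hwR, hR⟩ := exists_between (mem_ball_zero_iff.1 hw)
  have h := differentiableOn_tsum_of_summable_norm (U := Metric.ball (0 : ℂ) R)
    (F := atom p q ω M z Λ) ((ENNReal.summable_toReal hs).mul_right ((1 - R) ^ (-M)))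
    (fun k => (differentiableOn_atom hz k).mono (Metric.ball_subset_ball hR.le))
    Metric.isOpen_ball fun k v hv => norm_atom_le hω hM hz hR k (mem_ball_zero_iff.1 hv).le
  exact (h.differentiableAt
    (Metric.isOpen_ball.mem_nhds (mem_ball_zero_iff.2 hwR))).differentiableWithinAt

end Convergence

/-- atomic series with `ℓ^{p,q}` coefficients over a separated
sequence converge to functions in `A^{p,q}_ω`, with norm control. -/
theorem stmt0 (p : ℝ≥0∞) (hp : 0 < p) (q : ℝ) (hq : 0 < q)
    (K : ℝ) (hK : 1 < K)
    (ω : ℝ → ℝ) (hω : RadialWeight ω) (hωD : DClass ω)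
    (β Cβ : ℝ) (hβ : 0 < β) (hCβ : 0 < Cβ)
    (hβcond : ∀ r t : ℝ, 0 ≤ r → r ≤ t → t < 1 →
      wh ω r ≤ Cβ * ((1 - r) / (1 - t)) ^ β * wh ω t)
    (γ Cγ : ℝ) (hγ : 0 < γ) (hCγ : 0 < Cγ)
    (hγcond : ∀ t : ℝ, 0 ≤ t → t < 1 →
      (∫ s in (0:ℝ)..t, ((1 - t) / (1 - s)) ^ γ * ω s) ≤ Cγ * wh ω t)
    (z : ℕ → ℂ) (hz : ∀ k, z k ∈ Metric.ball (0:ℂ) 1) (hsep : Separated z)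
    (M : ℝ) (hM : 1 + p⁻¹.toReal + (β + γ) / q < M) :
    ∃ C : ℝ, 0 < C ∧ ∀ Λ : ℕ → ℂ, lpqNormE p q K z Λ < ⊤ →
      ∃ F : ℂ → ℂ, DifferentiableOn ℂ F (Metric.ball (0:ℂ) 1) ∧
        (∀ w ∈ Metric.ball (0:ℂ) 1,
          HasSum (fun k : ℕ =>
            Λ k * (((1 - ‖z k‖) ^ (M - p⁻¹.toReal) *
                (wh ω ‖z k‖) ^ (-(1/q)) : ℝ) : ℂ) /
              (1 - (starRingEnd ℂ) (z k) * w) ^ (M : ℂ)) (F w)) ∧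
        ApqNormE p q ω F ≤ ENNReal.ofReal C * lpqNormE p q K z Λ := by
  have hz' : ∀ k, ‖z k‖ < 1 := fun k => mem_ball_zero_iff.1 (hz k)
  have hM' : 1 + p⁻¹.toReal + β / q < M := by
    have : β / q ≤ (β + γ) / q := by gcongr; linarith
    linarith
  have hp0 : 0 ≤ p⁻¹.toReal := ENNReal.toReal_nonneg
  have hβq : 0 < β / q := by positivity
  obtain ⟨J, hJ⟩ := exists_annIdx hK hz'
  obtain ⟨C, hC, hbound⟩ := exists_ApqNormE_le hω hωD.2 hK hCβ hβcond hz' hsep hJ hp hq hβ hM'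
  refine ⟨C.toReal + 1, by positivity, fun Λ hΛ => ⟨fun w => ∑' k, atom p q ω M z Λ k w, ?_⟩⟩
  have hs := tsum_atomCoeff_ne_top hω hK hCβ hβcond hz' hsep hp hq hβ hM' hΛ.ne
  refine ⟨differentiableOn_tsum_atom hω (by linarith) hz' hs, fun w hw =>
    (summable_atom hω (by linarith) hz' hs (mem_ball_zero_iff.1 hw)).hasSum, ?_⟩
  refine (hbound Λ (atomCoeff p q ω M z Λ) _
    (fun k => atomCoeff_le hω hK hβcond hq hz' (by linarith) Λ (hJ k)) fun w hw => ?_).trans ?_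
  · refine enorm_tsum_le_tsum_enorm.trans (le_of_eq (tsum_congr fun k => ?_))
    exact enorm_atom hω hz' k hw.le
  · gcongr
    rw [← ENNReal.ofReal_toReal hC]
    refine ENNReal.ofReal_le_ofReal ?_
    rw [ENNReal.toReal_ofReal ENNReal.toReal_nonneg]
    linarith

end
end

section
/- Let 0<p≤∞, 0<q<∞ and ω∈D̂. Then there exists a constant C=C(p,q,ω)>0 such that M_∞(r,f)^q ŵ(r) (1−r)^{q/p} ≤ C ‖f‖_{A^{p,q}_ω}^q for every f∈A^{p,q}_ω and every 0≤r<1; equivalently, M_∞(r,f) ≤ C^{1/q} ‖f‖_{A^{p,q}_ω} ŵ(r)^{−1/q} (1−r)^{−1/p}. -/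
open MeasureTheory Complex
open scoped ENNReal Real

noncomputable section

/-- Membership in the mixed norm space `A^{p,q}_ω`. -/
def MemApq (p : ℝ≥0∞) (q : ℝ) (ω : ℝ → ℝ) (f : ℂ → ℂ) : Prop :=
  DifferentiableOn ℂ f (Metric.ball (0:ℂ) 1) ∧ ApqNormE p q ω f < ⊤

open Metric Filter Topology

/-- A nowhere vanishing holomorphic function on a disc has a holomorphic logarithm. -/
lemma exists_differentiableOn_exp_eq_on_ball {h : ℂ → ℂ} {c : ℂ} {R : ℝ}
    (hh : DifferentiableOn ℂ h (ball c R)) (h0 : ∀ z ∈ ball c R, h z ≠ 0) :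
    ∃ L : ℂ → ℂ, DifferentiableOn ℂ L (ball c R) ∧ ∀ z ∈ ball c R, exp (L z) = h z := by
  rcases le_or_gt R 0 with hR | hR
  · exact ⟨0, by simp [ball_eq_empty.2 hR], by simp [ball_eq_empty.2 hR]⟩
  have hc : c ∈ ball c R := mem_ball_self hR
  obtain ⟨L, hLc, hL⟩ := (((hh.deriv isOpen_ball).div hh h0).isExactOn_ball).with_val_at
    c (log (h c))
  refine ⟨L, fun z hz => (hL z hz).differentiableAt.differentiableWithinAt, fun z hz => ?_⟩
  have hd : ∀ w ∈ ball c R, HasDerivAt (fun w => h w * exp (-L w)) 0 w := by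
    intro w hw
    have h1 := (hh.differentiableAt (isOpen_ball.mem_nhds hw)).hasDerivAt
    convert! h1.mul (hL w hw).neg.cexp using 1
    simp only [Pi.div_apply]
    field_simp [h0 w hw]
    ring
  have key := isOpen_ball.is_const_of_deriv_eq_zero (convex_ball c R).isPreconnected
    (fun w hw => (hd w hw).differentiableAt.differentiableWithinAt)
    (fun w hw => (hd w hw).deriv) hz hc
  simp only [hLc, exp_neg, exp_log (h0 c hc), mul_inv_cancel₀ (h0 c hc)] at key
  field_simp at key
  exact key.symm

/-- Poisson kernel bound for holomorphic functions, in terms of the mean of the modulus. -/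
lemma norm_le_mul_circleAverage_norm {H : ℂ → ℂ} {R : ℝ} {z : ℂ}
    (hH : DiffContOnCl ℂ H (ball 0 R)) (hz : ‖z‖ < R) :
    ‖H z‖ ≤ (R + ‖z‖) / (R - ‖z‖) * Real.circleAverage (fun w => ‖H w‖) 0 R := by
  have hzb : z ∈ ball (0 : ℂ) R := by simpa using hz
  have hR : 0 < R := (norm_nonneg z).trans_lt hz
  have hcont : Continuous fun θ : ℝ => ‖H (circleMap 0 R θ)‖ := by
    refine (hH.continuousOn.comp_continuous (continuous_circleMap 0 R) fun θ => ?_).norm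
    rw [closure_ball _ hR.ne']
    exact circleMap_mem_closedBall 0 hR.le θ
  rw [← hH.circleAverage_poissonKernel_smul hzb, Real.circleAverage, Real.circleAverage,
    norm_smul, smul_eq_mul, Real.norm_of_nonneg (by positivity), mul_left_comm]
  gcongr
  rw [← intervalIntegral.integral_const_mul]
  refine intervalIntegral.norm_integral_le_of_norm_le (by positivity) ?_
    ((hcont.const_mul _).intervalIntegrable _ _)
  filter_upwards with θ _
  have hs : circleMap (0 : ℂ) R θ ∈ sphere (0 : ℂ) R := circleMap_mem_sphere 0 hR.le θ
  have hb := re_herglotzRieszKernel_le hs hzb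
  have hn : 0 ≤ poissonKernel 0 z (circleMap 0 R θ) := by
    rw [poissonKernel_def]
    have : ‖circleMap (0 : ℂ) R θ‖ = R := by simpa using hs
    simp only [sub_zero, this]
    have := pow_le_pow_left₀ (norm_nonneg z) hz.le 2
    exact div_nonneg (by linarith) (by positivity)
  simp only [Pi.smul_apply', norm_smul, Real.norm_of_nonneg hn]
  gcongr
  simpa [poissonKernel_eq_re_herglotzRieszKernel, herglotzRieszKernel_def] using hb

/-- Poisson bound for `‖h‖ ^ p`, where `h` does not vanish in the open disc. -/
lemma norm_rpow_le_mul_circleAverage_of_ne_zero {h : ℂ → ℂ} {R p : ℝ} {z : ℂ}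
    (hh : DiffContOnCl ℂ h (ball 0 R)) (h0 : ∀ z ∈ ball 0 R, h z ≠ 0) (hp : 0 < p)
    (hz : ‖z‖ < R) :
    ‖h z‖ ^ p ≤ (R + ‖z‖) / (R - ‖z‖) * Real.circleAverage (fun w => ‖h w‖ ^ p) 0 R := by
  obtain ⟨L, hLd, hL⟩ := exists_differentiableOn_exp_eq_on_ball hh.differentiableOn h0
  have hR : 0 < R := (norm_nonneg z).trans_lt hz
  have hnorm : ∀ w ∈ ball (0 : ℂ) R, ‖exp (p * L w)‖ = ‖h w‖ ^ p := by
    intro w hw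
    rw [← hL w hw, norm_exp, norm_exp, ← Real.exp_mul]
    simp [mul_comm]
  have hHd : DifferentiableOn ℂ (fun w => exp (p * L w)) (ball 0 R) :=
    (hLd.const_mul _).cexp
  have key : ∀ ρ ∈ Set.Ioo ‖z‖ R,
      ‖h z‖ ^ p ≤ (ρ + ‖z‖) / (ρ - ‖z‖) * Real.circleAverage (fun w => ‖h w‖ ^ p) 0 ρ := by
    intro ρ hρ
    have hρ0 : 0 < ρ := (norm_nonneg z).trans_lt hρ.1
    have hsub : closedBall (0 : ℂ) ρ ⊆ ball 0 R := closedBall_subset_ball hρ.2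
    have hdc : DiffContOnCl ℂ (fun w => exp (p * L w)) (ball 0 ρ) := by
      refine DifferentiableOn.diffContOnCl ?_
      rw [closure_ball _ hρ0.ne']
      exact hHd.mono hsub
    have := norm_le_mul_circleAverage_norm hdc hρ.1
    rw [hnorm z (by simpa using hz)] at this
    refine this.trans_eq ?_
    congr 1
    refine Real.circleAverage_congr_sphere fun w hw => hnorm w (hsub ?_)
    rw [abs_of_pos hρ0] at hw
    exact sphere_subset_closedBall hw
  have hcont : ContinuousOn (Real.circleAverage (fun w => ‖h w‖ ^ p) 0) (Set.Icc 0 R) := by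
    refine Real.ContinuousOn.circleAverage ?_ fun r hr => hr.1
    refine (hh.continuousOn.norm.rpow_const fun _ _ => Or.inr hp.le).mono fun w hw => ?_
    rw [closure_ball _ hR.ne']
    simpa using hw
  have hne : (𝓝[Set.Ioo ‖z‖ R] R).NeBot := by
    rw [← mem_closure_iff_nhdsWithin_neBot, closure_Ioo hz.ne]
    exact Set.right_mem_Icc.2 hz.le
  have hlim : ContinuousWithinAt (fun ρ => (ρ + ‖z‖) / (ρ - ‖z‖) *
      Real.circleAverage (fun w => ‖h w‖ ^ p) 0 ρ) (Set.Ioo ‖z‖ R) R := by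
    refine ContinuousWithinAt.mul ?_ ((hcont R ⟨hR.le, le_rfl⟩).mono fun ρ hρ =>
      ⟨(norm_nonneg z).trans hρ.1.le, hρ.2.le⟩)
    have : R - ‖z‖ ≠ 0 := (sub_pos.2 hz).ne'
    fun_prop (disch := assumption)
  exact ge_of_tendsto hlim (eventually_mem_nhdsWithin.mono key)

/-- The identity behind the Blaschke factor of the disc of radius `R`. -/
lemma norm_sq_sub_conj_mul (R : ℝ) (u z : ℂ) :
    ‖(R : ℂ) ^ 2 - (starRingEnd ℂ) u * z‖ ^ 2 =
      R ^ 2 * ‖z - u‖ ^ 2 + (R ^ 2 - ‖u‖ ^ 2) * (R ^ 2 - ‖z‖ ^ 2) := by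
  simp only [← normSq_eq_norm_sq, normSq_apply, ← ofReal_pow, sub_re, sub_im, mul_re, mul_im,
    conj_re, conj_im, ofReal_re, ofReal_im]
  ring

/-- Zeros in a disc can be removed by dividing by Blaschke factors. -/
lemma exists_analyticOnNhd_ne_zero_norm_eq_on_sphere {R : ℝ} {f : ℂ → ℂ}
    (hf : AnalyticOnNhd ℂ f (closedBall 0 R)) (hfin : {z ∈ ball 0 R | f z = 0}.Finite) :
    ∃ h : ℂ → ℂ, AnalyticOnNhd ℂ h (closedBall 0 R) ∧ (∀ z ∈ ball 0 R, h z ≠ 0) ∧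
      (∀ z ∈ closedBall 0 R, ‖f z‖ ≤ ‖h z‖) ∧ ∀ z ∈ sphere 0 R, ‖h z‖ = ‖f z‖ := by
  induction hn : {z ∈ ball 0 R | f z = 0}.ncard using Nat.strong_induction_on generalizing f with
  | _ n ih =>
  by_cases hex : ∃ u ∈ ball 0 R, f u = 0
  swap
  · push Not at hex
    exact ⟨f, hf, hex, fun _ _ => le_rfl, fun _ _ => rfl⟩
  obtain ⟨u, hu, hfu⟩ := hex
  have hR : 0 < R := pos_of_mem_ball hu
  have hnot : ¬ ∀ᶠ z in 𝓝 u, f z = 0 := by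
    intro hev
    refine infinite_of_mem_nhds u ?_ hfin
    filter_upwards [hev, isOpen_ball.mem_nhds hu] with z h1 h2 using ⟨h2, h1⟩
  obtain ⟨m, g, hg, hgu, hfg⟩ :=
    (hf u (ball_subset_closedBall hu)).exists_eventuallyEq_pow_smul_nonzero_iff.2 hnot
  let f₁ : ℂ → ℂ := Function.update (fun z => f z / (z - u) ^ m) u (g u)
  let b : ℂ → ℂ := fun z => ((R : ℂ) ^ 2 - (starRingEnd ℂ) u * z) / R
  have hf₁u : f₁ u = g u := Function.update_self ..
  have hf₁ne : ∀ z, z ≠ u → f₁ z = f z / (z - u) ^ m := fun z hz => Function.update_of_ne hz ..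
  have hff₁ : ∀ z, z ≠ u → f z = (z - u) ^ m * f₁ z := by
    intro z hz
    rw [hf₁ne z hz, mul_div_cancel₀ _ (pow_ne_zero _ (sub_ne_zero.2 hz))]
  have hf₁ : AnalyticOnNhd ℂ f₁ (closedBall 0 R) := by
    intro z hz
    by_cases hzu : z = u
    · subst hzu
      refine hg.congr ?_
      filter_upwards [hfg] with w hw
      by_cases hwz : w = z
      · rw [hwz, hf₁u]
      · rw [hf₁ne w hwz, hw, smul_eq_mul,
          mul_div_cancel_left₀ _ (pow_ne_zero _ (sub_ne_zero.2 hwz))]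
    · have : AnalyticAt ℂ (fun w => f w / (w - u) ^ m) z :=
        (hf z hz).div (by fun_prop) (pow_ne_zero _ (sub_ne_zero.2 hzu))
      refine this.congr ?_
      filter_upwards [isOpen_ne.mem_nhds hzu] with w hw using (hf₁ne w hw).symm
  have hb : AnalyticOnNhd ℂ b (closedBall 0 R) := fun z _ => by fun_prop
  have hub : ‖u‖ < R := by simpa using hu
  have hbsq : ∀ z, ‖b z‖ ^ 2 = ‖z - u‖ ^ 2 + (R ^ 2 - ‖u‖ ^ 2) * (R ^ 2 - ‖z‖ ^ 2) / R ^ 2 := by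
    intro z
    simp only [b, norm_div, div_pow, norm_sq_sub_conj_mul, norm_real, Real.norm_eq_abs, sq_abs]
    field_simp
  have hu2 : 0 < R ^ 2 - ‖u‖ ^ 2 := sub_pos.2 (pow_lt_pow_left₀ hub (norm_nonneg u) two_ne_zero)
  have hb0 : ∀ z ∈ ball 0 R, b z ≠ 0 := by
    intro z hz hbz
    have hz2 : 0 < R ^ 2 - ‖z‖ ^ 2 :=
      sub_pos.2 (pow_lt_pow_left₀ (by simpa using hz) (norm_nonneg z) two_ne_zero)
    have := hbsq z
    rw [hbz, norm_zero] at this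
    have : 0 < (R ^ 2 - ‖u‖ ^ 2) * (R ^ 2 - ‖z‖ ^ 2) / R ^ 2 := by positivity
    nlinarith [sq_nonneg ‖z - u‖]
  have hble : ∀ z ∈ closedBall 0 R, ‖z - u‖ ≤ ‖b z‖ := by
    intro z hz
    have hz2 : 0 ≤ R ^ 2 - ‖z‖ ^ 2 :=
      sub_nonneg.2 (pow_le_pow_left₀ (norm_nonneg z) (by simpa using hz) 2)
    refine (sq_le_sq₀ (norm_nonneg _) (norm_nonneg _)).1 ?_
    rw [hbsq z]
    exact le_add_of_nonneg_right (by positivity)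
  have hbeq : ∀ z ∈ sphere 0 R, ‖b z‖ = ‖z - u‖ := by
    intro z hz
    have hz' : ‖z‖ = R := by simpa using hz
    rw [← sq_eq_sq₀ (norm_nonneg _) (norm_nonneg _), hbsq z, hz']
    simp
  let F : ℂ → ℂ := fun z => b z ^ m * f₁ z
  have hF0 : ∀ z ∈ ball 0 R, (F z = 0 ↔ f z = 0 ∧ z ≠ u) := by
    intro z hz
    by_cases hzu : z = u
    · subst hzu
      simp [F, hf₁u, hgu, hb0 z hz]
    · simp [F, hb0 z hz, hzu, hff₁ z hzu, sub_ne_zero.2 hzu]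
  have hssub : {z ∈ ball 0 R | F z = 0} ⊂ {z ∈ ball 0 R | f z = 0} := by
    refine (Set.ssubset_iff_of_subset ?_).2 ⟨u, ⟨hu, hfu⟩, fun h => ((hF0 u hu).1 h.2).2 rfl⟩
    exact fun z hz => ⟨hz.1, ((hF0 z hz.1).1 hz.2).1⟩
  obtain ⟨h, hh, hh0, hle, heq⟩ := ih _ (hn ▸ Set.ncard_lt_ncard hssub hfin)
    ((hb.pow m).mul hf₁) (hfin.subset hssub.subset) rfl
  refine ⟨h, hh, hh0, fun z hz => le_trans ?_ (hle z hz), fun z hz => (heq z hz).trans ?_⟩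
  · by_cases hzu : z = u
    · rw [hzu, hfu, norm_zero]
      exact norm_nonneg _
    · rw [hff₁ z hzu]
      simp only [Pi.pow_apply, norm_mul, norm_pow]
      gcongr
      exact hble z hz
  · have hzu : z ≠ u := by
      rintro rfl
      simp [hub.ne] at hz
    rw [hff₁ z hzu]
    simp [hbeq z hz]

/-- Poisson bound for `‖f‖ ^ p`, where `f` is holomorphic near the closed disc. -/
lemma norm_rpow_le_mul_circleAverage {f : ℂ → ℂ} {R p : ℝ} {z : ℂ}
    (hf : AnalyticOnNhd ℂ f (closedBall 0 R)) (hp : 0 < p) (hz : ‖z‖ < R) :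
    ‖f z‖ ^ p ≤ (R + ‖z‖) / (R - ‖z‖) * Real.circleAverage (fun w => ‖f w‖ ^ p) 0 R := by
  have hR : 0 < R := (norm_nonneg z).trans_lt hz
  have hzR : z ∈ closedBall (0 : ℂ) R := by simpa using hz.le
  by_cases hfin : {z ∈ ball 0 R | f z = 0}.Finite
  · obtain ⟨h, hh, hh0, hle, heq⟩ := exists_analyticOnNhd_ne_zero_norm_eq_on_sphere hf hfin
    have hdc : DiffContOnCl ℂ h (ball 0 R) := by
      refine DifferentiableOn.diffContOnCl ?_
      rw [closure_ball _ hR.ne']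
      exact hh.differentiableOn
    refine (Real.rpow_le_rpow (norm_nonneg _) (hle z hzR) hp.le).trans <|
      (norm_rpow_le_mul_circleAverage_of_ne_zero hdc hh0 hp hz).trans_eq ?_
    congr 1
    refine Real.circleAverage_congr_sphere fun w hw => ?_
    rw [abs_of_pos hR] at hw
    simp only [heq w hw]
  · have hsub : {z ∈ ball 0 R | f z = 0} ⊆ closedBall 0 R :=
      fun w hw => ball_subset_closedBall hw.1
    obtain ⟨a, ha, hacc⟩ := Set.Infinite.exists_accPt_of_subset_isCompact hfin
      (isCompact_closedBall 0 R) hsub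
    have hfreq : ∃ᶠ w in 𝓝[≠] a, f w = 0 :=
      (accPt_iff_frequently_nhdsNE.1 hacc).mono fun w hw => hw.2
    have h0 := hf.eqOn_zero_of_preconnected_of_frequently_eq_zero
      (convex_closedBall 0 R).isPreconnected ha hfreq hzR
    rw [h0, Pi.zero_apply, norm_zero, Real.zero_rpow hp.ne']
    have hnn : 0 ≤ Real.circleAverage (fun w => ‖f w‖ ^ p) 0 R :=
      Real.circleAverage_nonneg_of_nonneg fun w _ => by positivity
    have := sub_pos.2 hz
    positivity

lemma circ_eq_circleMap (r t : ℝ) : circ r t = circleMap 0 r t := by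
  simp [circ, circleMap]

lemma Mp_of_ne_top {p : ℝ≥0∞} (hp : p ≠ ⊤) (f : ℂ → ℂ) (r : ℝ) :
    Mp p f r = Real.circleAverage (fun w => ‖f w‖ ^ p.toReal) 0 r ^ p.toReal⁻¹ := by
  simp [Mp, hp, Real.circleAverage, circ_eq_circleMap]

lemma Mp_nonneg (p : ℝ≥0∞) (f : ℂ → ℂ) (r : ℝ) : 0 ≤ Mp p f r := by
  by_cases hp : p = ⊤
  · simpa [Mp, hp] using Real.iSup_nonneg fun t => norm_nonneg (f (circ r t))
  · rw [Mp_of_ne_top hp]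
    exact Real.rpow_nonneg (Real.circleAverage_nonneg_of_nonneg fun w _ => by positivity) _

/-- Comparison of the maximum modulus with an integral mean of larger radius. -/
lemma Mp_top_mul_rpow_le {p : ℝ≥0∞} (hp : 0 < p) {f : ℂ → ℂ}
    (hf : DifferentiableOn ℂ f (ball 0 1)) {r s : ℝ} (hr : 0 ≤ r) (hrs : (1 + r) / 2 < s)
    (hs : s < 1) :
    Mp ⊤ f r * (1 - r) ^ p⁻¹.toReal ≤ 4 ^ p⁻¹.toReal * Mp p f s := by
  have hs0 : 0 < s := by linarith
  have hfs : AnalyticOnNhd ℂ f (closedBall 0 s) :=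
    (hf.analyticOnNhd isOpen_ball).mono (closedBall_subset_ball hs)
  have hcirc : ∀ t, ‖circ r t‖ = r := fun t => by
    simp [circ_eq_circleMap, abs_of_nonneg hr]
  have hr1 : 0 < 1 - r := by linarith
  rw [← le_div_iff₀ (by positivity)]
  refine (show Mp ⊤ f r = ⨆ t : ℝ, ‖f (circ r t)‖ by simp [Mp]).trans_le (ciSup_le fun t => ?_)
  rw [le_div_iff₀ (by positivity)]
  by_cases hpt : p = ⊤
  · subst hpt
    simp only [ENNReal.inv_top, ENNReal.toReal_zero, Real.rpow_zero, mul_one, one_mul]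
    have hdc : DiffContOnCl ℂ f (ball 0 s) := by
      refine DifferentiableOn.diffContOnCl ?_
      rw [closure_ball _ hs0.ne']
      exact hfs.differentiableOn
    refine norm_le_of_forall_mem_frontier_norm_le isBounded_ball hdc (fun w hw => ?_)
      (subset_closure (mem_ball_zero_iff.2 ((hcirc t).trans_lt (by linarith))))
    rw [frontier_ball _ hs0.ne'] at hw
    have hbdd : BddAbove (Set.range fun t : ℝ => ‖f (circ s t)‖) := by
      obtain ⟨M, hM⟩ := (isCompact_closedBall (0 : ℂ) s).exists_bound_of_continuousOn
        hfs.continuousOn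
      refine ⟨M, ?_⟩
      rintro _ ⟨t, rfl⟩
      exact hM _ (by simpa [circ_eq_circleMap] using circleMap_mem_closedBall 0 hs0.le t)
    rw [← abs_of_pos hs0, ← range_circleMap] at hw
    obtain ⟨θ, rfl⟩ := hw
    simpa [Mp, circ_eq_circleMap] using le_ciSup hbdd θ
  · have hp0 : 0 < p.toReal := ENNReal.toReal_pos hp.ne' hpt
    have key := norm_rpow_le_mul_circleAverage hfs hp0 ((hcirc t).trans_lt (by linarith))
    rw [hcirc] at key
    set A := Real.circleAverage (fun w => ‖f w‖ ^ p.toReal) 0 s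
    have hA : 0 ≤ A := Real.circleAverage_nonneg_of_nonneg fun w _ => by positivity
    have key2 : ‖f (circ r t)‖ ^ p.toReal * (1 - r) ≤ 4 * A := by
      refine (mul_le_mul_of_nonneg_right key hr1.le).trans ?_
      rw [mul_right_comm]
      gcongr
      rw [div_mul_eq_mul_div, div_le_iff₀ (by linarith)]
      nlinarith
    have := Real.rpow_le_rpow (by positivity) key2 (inv_nonneg.2 hp0.le)
    rwa [Real.mul_rpow (by positivity) hr1.le, Real.mul_rpow (by norm_num) hA,
      Real.rpow_rpow_inv (norm_nonneg _) hp0.ne', ← Mp_of_ne_top hpt, ← ENNReal.toReal_inv] at this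

lemma ofReal_wh {ω : ℝ → ℝ} (hω : RadialWeight ω) {r : ℝ} (hr : 0 ≤ r) (hr1 : r ≤ 1) :
    ENNReal.ofReal (wh ω r) = ∫⁻ s in Set.Ioo r 1, ENNReal.ofReal (ω s) := by
  have hint : IntegrableOn ω (Set.Ioc r 1) :=
    (hω.2.1).mono_set (Set.Ioc_subset_Ioc_left hr)
  rw [wh, intervalIntegral.integral_of_le hr1,
    ofReal_integral_eq_lintegral_ofReal hint (ae_of_all _ hω.1), Measure.restrict_congr_set
      Ioo_ae_eq_Ioc]

/-- for `ω ∈ D̂` there is `C > 0` with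
`M_∞(r,f)^q ŵ(r) (1−r)^{q/p} ≤ C ‖f‖_{A^{p,q}_ω}^q` for all `f ∈ A^{p,q}_ω`, `0 ≤ r < 1`. -/
theorem stmt10 (p : ℝ≥0∞) (hp : 0 < p) (q : ℝ) (hq : 0 < q)
    (ω : ℝ → ℝ) (hω : RadialWeight ω) (hωD : Dhat ω) :
    ∃ C : ℝ, 0 < C ∧ ∀ f : ℂ → ℂ, MemApq p q ω f → ∀ r : ℝ, 0 ≤ r → r < 1 →
      ENNReal.ofReal (Mp ⊤ f r) ^ q * ENNReal.ofReal (wh ω r) *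
          ENNReal.ofReal ((1 - r) ^ (q * p⁻¹.toReal)) ≤
        ENNReal.ofReal C * ApqNormE p q ω f ^ q := by
  obtain ⟨C, hC1, hC⟩ := hωD
  set a := p⁻¹.toReal
  have hC0 : 0 < C := by linarith
  refine ⟨C * (4 ^ a) ^ q, by positivity, fun f hf r hr hr1 => ?_⟩
  set M := Mp ⊤ f r
  have hM0 : 0 ≤ M := Mp_nonneg _ _ _
  have hr1' : 0 < 1 - r := by linarith
  set K : ℝ≥0∞ := ENNReal.ofReal (M * (1 - r) ^ a) ^ q with hK
  have hKtop : K ≠ ⊤ := ENNReal.rpow_ne_top_of_nonneg hq.le ENNReal.ofReal_ne_top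
  have hnorm : ApqNormE p q ω f ^ q =
      ∫⁻ s in Set.Ioo (0:ℝ) 1, ENNReal.ofReal (Mp p f s) ^ q * ENNReal.ofReal (ω s) :=
    ENNReal.rpow_inv_rpow hq.ne' _
  calc ENNReal.ofReal M ^ q * ENNReal.ofReal (wh ω r) * ENNReal.ofReal ((1 - r) ^ (q * a))
      = K * ENNReal.ofReal (wh ω r) := by
        rw [hK, ENNReal.ofReal_mul hM0, ENNReal.mul_rpow_of_nonneg _ _ hq.le,
          ENNReal.ofReal_rpow_of_nonneg (by positivity : 0 ≤ (1 - r) ^ a) hq.le,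
          ← Real.rpow_mul hr1'.le, mul_comm a q]
        ring
    _ ≤ K * (ENNReal.ofReal C * ENNReal.ofReal (wh ω ((1 + r) / 2))) := by
        rw [← ENNReal.ofReal_mul hC0.le]
        gcongr
        exact hC r hr hr1
    _ = ENNReal.ofReal C * ∫⁻ s in Set.Ioo ((1 + r) / 2) 1, K * ENNReal.ofReal (ω s) := by
        rw [ofReal_wh hω (by linarith) (by linarith), lintegral_const_mul' _ _ hKtop]
        ring
    _ ≤ ENNReal.ofReal C * ∫⁻ s in Set.Ioo ((1 + r) / 2) 1, ENNReal.ofReal ((4 ^ a) ^ q) *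
          (ENNReal.ofReal (Mp p f s) ^ q * ENNReal.ofReal (ω s)) := by
        refine mul_le_mul_right (setLIntegral_mono' measurableSet_Ioo fun s hs => ?_) _
        rw [← mul_assoc]
        gcongr
        rw [← ENNReal.ofReal_rpow_of_nonneg (by positivity) hq.le,
          ← ENNReal.mul_rpow_of_nonneg _ _ hq.le, ← ENNReal.ofReal_mul (by positivity)]
        exact ENNReal.rpow_le_rpow
          (ENNReal.ofReal_le_ofReal (Mp_top_mul_rpow_le hp hf.1 hr hs.1 hs.2)) hq.le
    _ ≤ ENNReal.ofReal C * ∫⁻ s in Set.Ioo (0 : ℝ) 1, ENNReal.ofReal ((4 ^ a) ^ q) *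
          (ENNReal.ofReal (Mp p f s) ^ q * ENNReal.ofReal (ω s)) := by
        exact mul_le_mul_right
          (lintegral_mono_set (Set.Ioo_subset_Ioo_left (by linarith))) _
    _ = ENNReal.ofReal (C * (4 ^ a) ^ q) * ApqNormE p q ω f ^ q := by
        rw [lintegral_const_mul' _ _ ENNReal.ofReal_ne_top, hnorm, ENNReal.ofReal_mul hC0.le,
          mul_assoc]

end
end

section
/- Let K∈ℕ with K≥2 and n∈ℕ∪{0}. Then there is a constant C=C(K,n)>0 such that for every function f analytic on 𝔻, every j∈ℕ∪{0}, every l∈{0,…,K^{j+3}−1} and every ζ∈Q_{j,l}, |f^{(n)}(ζ)| ≤ C K^{jn} sup_{w∈Q̂_{j,l}} |f(w)|. -/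
open Complex
open scoped ENNReal Real

noncomputable section

/-- The radii `r_j = 1 − K^{−j}`. -/
def rK (K : ℕ) (j : ℕ) : ℝ := 1 - ((K : ℝ) ^ j)⁻¹

/-- The dyadic polar rectangle `Q_{j,l}`. -/
def Qset (K j l : ℕ) : Set ℂ :=
  {w : ℂ | rK K j ≤ ‖w‖ ∧ ‖w‖ < rK K (j + 1) ∧
    ∃ θ : ℝ, 2 * Real.pi * l / (K : ℝ) ^ (j + 3) ≤ θ ∧
      θ < 2 * Real.pi * (l + 1) / (K : ℝ) ^ (j + 3) ∧
      w = (‖w‖ : ℂ) * Complex.exp ((θ : ℂ) * Complex.I)}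

/-- The (Euclidean) distance between two subsets of `ℂ`. -/
def setDist (A B : Set ℂ) : ℝ≥0∞ := ⨅ a ∈ A, EMetric.infEdist a B

/-- The enlarged rectangle `Q̂_{j,l}`, the union of the rectangles `Q_{i,m}` at
distance at most `K^{−(j+1)}(1 − 1/K)` from `Q_{j,l}`. -/
def Qhat (K j l : ℕ) : Set ℂ :=
  ⋃ (i : ℕ) (m : ℕ) (_ : m < K ^ (i + 3))
    (_ : setDist (Qset K i m) (Qset K j l) ≤
      ENNReal.ofReal (((K : ℝ) ^ (j + 1))⁻¹ * (1 - (K : ℝ)⁻¹))), Qset K i m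

theorem rK_succ (K j : ℕ) : rK K (j + 1) = 1 - (1 - rK K j) / K := by
  simp only [rK, pow_succ, mul_inv]
  ring

theorem rK_lt_one {K : ℕ} (hK : 0 < K) (j : ℕ) : rK K j < 1 := by
  have : (0 : ℝ) < K := by exact_mod_cast hK
  have : 0 < ((K : ℝ) ^ j)⁻¹ := by positivity
  unfold rK
  linarith

theorem rK_succ_add_gap (K j : ℕ) :
    rK K (j + 1) + ((K : ℝ) ^ (j + 1))⁻¹ * (1 - (K : ℝ)⁻¹) = rK K (j + 2) := by
  simp only [rK, pow_succ, mul_inv]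
  ring

/-- The rectangles `Q_{j,l}` cover the unit disc. -/
theorem exists_mem_Qset {K : ℕ} (hK : 2 ≤ K) {w : ℂ} (hw : ‖w‖ < 1) :
    ∃ i m : ℕ, m < K ^ (i + 3) ∧ w ∈ Qset K i m := by
  have hK1 : (1 : ℝ) < K := by exact_mod_cast hK
  have hK0 : (0 : ℝ) < K := by linarith
  have hpos : 0 < 1 - ‖w‖ := by linarith
  have hx : 1 ≤ (1 - ‖w‖)⁻¹ := (one_le_inv₀ hpos).2 (by linarith [norm_nonneg w])
  obtain ⟨i, hi, hi'⟩ := exists_nat_pow_near hx hK1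
  have hp : (0 : ℝ) < (K : ℝ) ^ (i + 3) := by positivity
  have hpi := Real.two_pi_pos
  obtain ⟨θ, hθ0, hθ1, hθ⟩ : ∃ θ : ℝ, 0 ≤ θ ∧ θ < 2 * π ∧
      w = (‖w‖ : ℂ) * Complex.exp ((θ : ℂ) * Complex.I) := by
    rcases le_or_gt 0 (arg w) with h | h
    · exact ⟨arg w, h, by linarith [arg_le_pi w, Real.pi_pos], (norm_mul_exp_arg_mul_I w).symm⟩
    · refine ⟨arg w + 2 * π, by linarith [neg_pi_lt_arg w], by linarith, ?_⟩
      have : ((arg w + 2 * π : ℝ) : ℂ) * I = arg w * I + 2 * π * I := by push_cast; ring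
      rw [this, Complex.exp_periodic, norm_mul_exp_arg_mul_I]
  have hy : 0 ≤ θ * (K : ℝ) ^ (i + 3) / (2 * π) := by positivity
  refine ⟨i, ⌊θ * (K : ℝ) ^ (i + 3) / (2 * π)⌋₊, ?_, ?_, ?_, θ, ?_, ?_, hθ⟩
  · rw [Nat.floor_lt hy]
    push_cast
    rw [div_lt_iff₀ hpi, mul_comm]
    exact mul_lt_mul_of_pos_left hθ1 hp
  · have := inv_anti₀ (by positivity) hi
    rw [inv_inv] at this
    unfold rK
    linarith
  · have := inv_strictAnti₀ (by positivity) hi'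
    rw [inv_inv] at this
    unfold rK
    linarith
  · have := Nat.floor_le hy
    rw [le_div_iff₀ hpi] at this
    rw [div_le_iff₀ hp]
    linarith
  · have := Nat.lt_floor_add_one (θ * (K : ℝ) ^ (i + 3) / (2 * π))
    rw [div_lt_iff₀ hpi] at this
    rw [lt_div_iff₀ hp]
    linarith

theorem setDist_le_edist {A B : Set ℂ} {a b : ℂ} (ha : a ∈ A) (hb : b ∈ B) :
    setDist A B ≤ edist a b :=
  (iInf₂_le a ha).trans (Metric.infEDist_le_edist_of_mem hb)

theorem rK_sub_le_setDist (K i m j l : ℕ) :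
    ENNReal.ofReal (rK K i - rK K (j + 1)) ≤ setDist (Qset K i m) (Qset K j l) := by
  refine le_iInf₂ fun a ha ↦ Metric.le_infEDist.2 fun b hb ↦ ?_
  rw [edist_dist, dist_eq_norm]
  exact ENNReal.ofReal_le_ofReal (by linarith [norm_sub_norm_le a b, ha.1, hb.2.1])

theorem Qhat_subset_closedBall {K : ℕ} (hK : 2 ≤ K) (j l : ℕ) :
    Qhat K j l ⊆ Metric.closedBall 0 (rK K (j + 3)) := by
  intro w hw
  simp only [Qhat, Set.mem_iUnion, exists_prop] at hw
  obtain ⟨i, m, -, hd, hw⟩ := hw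
  have hK1 : (1 : ℝ) < K := by exact_mod_cast hK
  have hgap : 0 ≤ ((K : ℝ) ^ (j + 1))⁻¹ * (1 - (K : ℝ)⁻¹) :=
    mul_nonneg (by positivity) (sub_nonneg.2 (inv_le_one_of_one_le₀ hK1.le))
  have h := (ENNReal.ofReal_le_ofReal_iff hgap).1 ((rK_sub_le_setDist K i m j l).trans hd)
  have hij : rK K i ≤ rK K (j + 2) := by linarith [rK_succ_add_gap K j]
  rw [mem_closedBall_zero_iff]
  refine hw.2.1.le.trans ?_
  rw [rK_succ, rK_succ K (j + 2)]
  gcongr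

theorem closedBall_subset_Qhat {K : ℕ} (hK : 2 ≤ K) {j l : ℕ} {ζ : ℂ} (hζ : ζ ∈ Qset K j l) :
    Metric.closedBall ζ (((K : ℝ) ^ (j + 1))⁻¹ * (1 - (K : ℝ)⁻¹)) ⊆ Qhat K j l := by
  intro w hw
  have hw' : dist w ζ ≤ ((K : ℝ) ^ (j + 1))⁻¹ * (1 - (K : ℝ)⁻¹) := hw
  have h1 : ‖w‖ < 1 := by
    have := norm_sub_norm_le w ζ
    rw [dist_eq_norm] at hw'
    linarith [rK_succ_add_gap K j, rK_lt_one (by omega : 0 < K) (j + 2), hζ.2.1]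
  obtain ⟨i, m, hm, hwQ⟩ := exists_mem_Qset hK h1
  simp only [Qhat, Set.mem_iUnion, exists_prop]
  refine ⟨i, m, hm, (setDist_le_edist hwQ hζ).trans ?_, hwQ⟩
  rw [edist_dist]
  exact ENNReal.ofReal_le_ofReal hw'

theorem norm_le_biSup {f : ℂ → ℂ} {s t : Set ℂ} (ht : IsCompact t) (hf : ContinuousOn f t)
    (hst : s ⊆ t) {w : ℂ} (hw : w ∈ s) : ‖f w‖ ≤ ⨆ w ∈ s, ‖f w‖ := by
  obtain ⟨B, hB⟩ := ht.exists_bound_of_continuousOn hf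
  have hbdd : BddAbove (Set.range fun w ↦ ⨆ _ : w ∈ s, ‖f w‖) := by
    refine ⟨max B 0, ?_⟩
    rintro _ ⟨z, rfl⟩
    exact Real.iSup_le (fun hz ↦ (hB z (hst hz)).trans (le_max_left _ _)) (le_max_right _ _)
  have := le_ciSup hbdd w
  simpa only [ciSup_pos hw] using this

/-- Cauchy-type estimate `|f^{(n)}(ζ)| ≤ C K^{jn} sup_{Q̂_{j,l}} |f|`
for `ζ ∈ Q_{j,l}`. -/
theorem stmt13 (K : ℕ) (hK : 2 ≤ K) (n : ℕ) :
    ∃ C : ℝ, 0 < C ∧ ∀ f : ℂ → ℂ, DifferentiableOn ℂ f (Metric.ball (0:ℂ) 1) →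
      ∀ j l : ℕ, l < K ^ (j + 3) → ∀ ζ ∈ Qset K j l,
        ‖iteratedDeriv n f ζ‖ ≤
          C * (K : ℝ) ^ (j * n) * ⨆ w ∈ Qhat K j l, ‖f w‖ := by
  have hK1 : (1 : ℝ) < K := by exact_mod_cast hK
  have hK0 : (0 : ℝ) < K := by linarith
  have hc : 0 < 1 - (K : ℝ)⁻¹ := sub_pos.2 (inv_lt_one_of_one_lt₀ hK1)
  refine ⟨n.factorial * (K / (1 - (K : ℝ)⁻¹)) ^ n, by positivity, ?_⟩
  intro f hf j l _ ζ hζ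
  have hR : 0 < ((K : ℝ) ^ (j + 1))⁻¹ * (1 - (K : ℝ)⁻¹) := by positivity
  have hsub := closedBall_subset_Qhat hK hζ
  have hcb := Qhat_subset_closedBall hK j l
  have hdisc : Metric.closedBall (0 : ℂ) (rK K (j + 3)) ⊆ Metric.ball 0 1 :=
    Metric.closedBall_subset_ball (rK_lt_one (by omega) _)
  have hd : DiffContOnCl ℂ f (Metric.ball ζ (((K : ℝ) ^ (j + 1))⁻¹ * (1 - (K : ℝ)⁻¹))) :=
    (hf.mono ((hsub.trans hcb).trans hdisc)).diffContOnCl_ball subset_rfl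
  have hM : ∀ z ∈ Metric.sphere ζ (((K : ℝ) ^ (j + 1))⁻¹ * (1 - (K : ℝ)⁻¹)),
      ‖f z‖ ≤ ⨆ w ∈ Qhat K j l, ‖f w‖ := fun z hz ↦
    norm_le_biSup (isCompact_closedBall 0 (rK K (j + 3))) (hf.continuousOn.mono hdisc) hcb
      (hsub (Metric.sphere_subset_closedBall hz))
  refine (norm_iteratedDeriv_le_of_forall_mem_sphere_norm_le n hR hd hM).trans_eq ?_
  have hc' := hc.ne'
  generalize 1 - (K : ℝ)⁻¹ = c at hc'
  rw [pow_mul, mul_pow, inv_pow, div_pow, pow_succ, mul_pow]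
  field_simp

end
end
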